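/- arXiv:1103.2312 — 3 statements merged into one kernel-verified Lean document; each statement's English description precedes it below -/
import Mathlib

section
/- Let E be a countable Borel equivalence relation on a standard Borel space X. Then E is smooth if and only if E is invariantly Borel bounded. -/
open Filter

/-- Eventual domination on `ℕ → ℕ`. -/
def EvLe (α β : ℕ → ℕ) : Prop := ∀ᶠ n in Filter.atTop, α n ≤ β n

/-- `E` is smooth: there is a Borel function to a standard Borel space
(equivalently, to `ℝ`) whose fibers are exactly the `E`-classes. -/
def SmoothER {X : Type*} [MeasurableSpace X] (E : X → X → Prop) : Prop :=
  ∃ f : X → ℝ, Measurable f ∧ ∀ x y, E x y ↔ f x = f y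

/-- `E` is invariantly Borel bounded: every Borel `φ : X → ℕ^ℕ` is eventually
dominated by an `E`-invariant Borel function `ψ : X → ℕ^ℕ`. -/
def InvariantlyBorelBounded {X : Type*} [MeasurableSpace X] (E : X → X → Prop) : Prop :=
  ∀ φ : X → ℕ → ℕ, Measurable φ →
    ∃ ψ : X → ℕ → ℕ, Measurable ψ ∧ (∀ x y, E x y → ψ x = ψ y) ∧
      ∀ x, EvLe (φ x) (ψ x)

open Set MeasureTheory Topology

section CountableToOne

variable {X : Type*}

/-- `B` is a countable union of measurable sets on which `f` is injective. -/
def SigmaInjOn [MeasurableSpace X] (f : X → ℝ) (B : Set X) : Prop :=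
  ∃ 𝓐 : Set (Set X), 𝓐.Countable ∧ (∀ A ∈ 𝓐, MeasurableSet A ∧ InjOn f A) ∧ B = ⋃₀ 𝓐

theorem SigmaInjOn.iUnion [MeasurableSpace X] {f : X → ℝ} {ι : Type*} [Countable ι]
    {B : ι → Set X} (h : ∀ i, SigmaInjOn f (B i)) : SigmaInjOn f (⋃ i, B i) := by
  choose 𝓐 hc hA hB using h
  refine ⟨⋃ i, 𝓐 i, countable_iUnion hc, fun A hA' => ?_, ?_⟩
  · obtain ⟨i, hi⟩ := mem_iUnion.1 hA'
    exact hA i A hi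
  · rw [sUnion_iUnion]
    exact iUnion_congr hB

theorem SigmaInjOn.of_injOn [MeasurableSpace X] {f : X → ℝ} {A : Set X}
    (hA : MeasurableSet A) (hf : InjOn f A) : SigmaInjOn f A :=
  ⟨{A}, countable_singleton A, by simp [hA, hf], by simp⟩

theorem SigmaInjOn.measurableSet [MeasurableSpace X] {f : X → ℝ} {B : Set X}
    (h : SigmaInjOn f B) : MeasurableSet B := by
  obtain ⟨𝓐, hc, hA, rfl⟩ := h
  exact MeasurableSet.sUnion hc fun A h => (hA A h).1

/-- Every point of the fibers of `f` through `S` can be doubled inside any prescribed open set,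
while preserving finitely many open conditions on the fiber. -/
def IsSplitting [TopologicalSpace X] (f : X → ℝ) (S : Set X) : Prop :=
  ∀ 𝓕 : Set (Set X), 𝓕.Finite → (∀ W ∈ 𝓕, IsOpen W) → ∀ U ∈ 𝓕, ∀ c, (∀ W ∈ 𝓕, c ∈ f '' (W ∩ S)) →
    ∃ x ∈ U ∩ S, ∃ y ∈ U ∩ S, x ≠ y ∧ f x = f y ∧ ∀ W ∈ 𝓕, f x ∈ f '' (W ∩ S)

theorem analyticSet_inter [TopologicalSpace X] [T2Space X] {s t : Set X} (hs : AnalyticSet s) (ht : AnalyticSet t) :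
    AnalyticSet (s ∩ t) := by
  rw [inter_eq_iInter]
  exact AnalyticSet.iInter fun b => by cases b <;> assumption

section Polish

variable [TopologicalSpace X] [PolishSpace X] [MeasurableSpace X] [BorelSpace X] {f : X → ℝ}

theorem analyticSet_fiber_neighbors (hf : Continuous f) {A : Set X} (hA : AnalyticSet A) :
    AnalyticSet {y | ∃ x ∈ A, f x = f y ∧ x ≠ y} := by
  have h1 : AnalyticSet ((Prod.fst : X × X → X) ⁻¹' A) := hA.preimage continuous_fst
  have h2 : MeasurableSet {p : X × X | f p.1 = f p.2 ∧ p.1 ≠ p.2} := by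
    refine MeasurableSet.inter ?_ ?_
    · exact (isClosed_eq (hf.comp continuous_fst) (hf.comp continuous_snd)).measurableSet
    · exact (isClosed_eq continuous_fst continuous_snd).measurableSet.compl
  convert (analyticSet_inter h1 h2.analyticSet).image_of_continuous continuous_snd using 1
  ext y
  simp

theorem exists_measurableSet_injOn_superset (hf : Continuous f) {A : Set X} (hA : AnalyticSet A)
    (hinj : InjOn f A) : ∃ B, MeasurableSet B ∧ A ⊆ B ∧ InjOn f B := by
  obtain ⟨B, hAB, hB, hBm⟩ := hA.measurablySeparable (analyticSet_fiber_neighbors hf hA) <| by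
    rw [disjoint_left]
    rintro y hy ⟨x, hx, hxy, hne⟩
    exact hne (hinj hx hy hxy)
  obtain ⟨C, hAC, hC, hCm⟩ := hA.measurablySeparable
    (analyticSet_fiber_neighbors hf hBm.analyticSet) <| by
    rw [disjoint_left]
    rintro y hy ⟨x, hx, hxy, hne⟩
    exact disjoint_left.1 hB ⟨y, hy, hxy.symm, hne.symm⟩ hx
  refine ⟨B ∩ C, hBm.inter hCm, subset_inter hAB hAC, fun x hx y hy hxy => ?_⟩
  by_contra hne
  exact disjoint_left.1 hC ⟨x, hx.1, hxy, hne⟩ hy.2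

theorem exists_sigmaInjOn_isSplitting_compl (hf : Continuous f) :
    ∃ B, SigmaInjOn f B ∧ IsSplitting f Bᶜ := by
  classical
  let b := TopologicalSpace.countableBasis X
  have hb := TopologicalSpace.isBasis_countableBasis X
  have : Countable b := (TopologicalSpace.countable_countableBasis X).to_subtype
  let core : Finset b × b → Set X → Set X := fun p B =>
    {x | x ∈ p.2.1 ∩ Bᶜ ∧ ∀ W ∈ p.1, f x ∈ f '' (W.1 ∩ Bᶜ)}
  have core_anti : ∀ p {B B' : Set X}, B ⊆ B' → core p B' ⊆ core p B := by
    intro p B B' h x hx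
    exact ⟨⟨hx.1.1, fun h' => hx.1.2 (h h')⟩, fun W hW =>
      image_mono (inter_subset_inter_right _ (compl_subset_compl.2 h)) (hx.2 W hW)⟩
  have core_analytic : ∀ p {B : Set X}, MeasurableSet B → AnalyticSet (core p B) := by
    intro p B hB
    have h1 : AnalyticSet (p.2.1 ∩ Bᶜ) :=
      ((hb.isOpen p.2.2).measurableSet.inter hB.compl).analyticSet
    have h2 : ∀ W : b, AnalyticSet (f ⁻¹' (f '' (W.1 ∩ Bᶜ))) := fun W =>
      (((hb.isOpen W.2).measurableSet.inter hB.compl).analyticSet.image_of_continuous hf).preimage hf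
    have h3 : core p B = ⋂ o : Option p.1,
        o.elim (p.2.1 ∩ Bᶜ) fun W => f ⁻¹' (f '' (W.1.1 ∩ Bᶜ)) := by
      ext x
      simp [core, Option.forall]
    rw [h3]
    refine AnalyticSet.iInter ?_
    rintro (_ | W)
    exacts [h1, h2 W.1]
  have choice₁ : ∀ p, ∃ B, SigmaInjOn f B ∧
      ((∃ B', SigmaInjOn f B' ∧ InjOn f (core p B')) → InjOn f (core p B)) := by
    intro p
    by_cases h : ∃ B', SigmaInjOn f B' ∧ InjOn f (core p B')
    · obtain ⟨B, h1, h2⟩ := h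
      exact ⟨B, h1, fun _ => h2⟩
    · exact ⟨∅, .of_injOn .empty (injOn_empty f), fun h' => absurd h' h⟩
  choose B₁ hB₁ hB₁' using choice₁
  have hBu : SigmaInjOn f (⋃ p, B₁ p) := .iUnion hB₁
  have choice₂ : ∀ p, ∃ B, SigmaInjOn f B ∧
      (InjOn f (core p (⋃ p, B₁ p)) → core p (⋃ p, B₁ p) ⊆ B) := by
    intro p
    by_cases h : InjOn f (core p (⋃ p, B₁ p))
    · obtain ⟨B, h1, h2, h3⟩ :=
        exists_measurableSet_injOn_superset hf (core_analytic p hBu.measurableSet) h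
      exact ⟨B, .of_injOn h1 h3, fun _ => h2⟩
    · exact ⟨∅, .of_injOn .empty (injOn_empty f), fun h' => absurd h' h⟩
  choose B₂ hB₂ hB₂' using choice₂
  have hB : SigmaInjOn f (⋃ p, (B₁ p ∪ B₂ p)) := .iUnion fun p => by
    rw [union_eq_iUnion]
    exact .iUnion fun b => by cases b <;> simp [hB₁, hB₂]
  set B := ⋃ p, (B₁ p ∪ B₂ p) with hBdef
  have hsub : (⋃ p, B₁ p) ⊆ B := iUnion_mono fun p => subset_union_left
  have key : ∀ p, InjOn f (core p B) → core p B = ∅ := by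
    intro p h
    have h1 := hB₁' p ⟨B, hB, h⟩
    have h2 := hB₂' p (h1.mono (core_anti p (subset_iUnion _ p)))
    refine eq_empty_of_forall_notMem fun x hx => hx.1.2 ?_
    exact mem_iUnion.2 ⟨p, Or.inr (h2 (core_anti p hsub hx))⟩
  refine ⟨B, hB, fun 𝓕 hfin hop U hU c hc => ?_⟩
  have hbasic : ∀ W : 𝓕, ∃ V : b, V.1 ⊆ W ∧ c ∈ f '' (V.1 ∩ Bᶜ) := by
    rintro ⟨W, hW⟩
    obtain ⟨x, ⟨hx, hxB⟩, rfl⟩ := hc W hW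
    obtain ⟨V, hV, hxV, hVW⟩ := hb.exists_subset_of_mem_open hx (hop W hW)
    exact ⟨⟨V, hV⟩, hVW, x, ⟨hxV, hxB⟩, rfl⟩
  choose V hVW hV using hbasic
  have := hfin.to_subtype
  have := Fintype.ofFinite 𝓕
  obtain ⟨x, hx, hxc⟩ := hV ⟨U, hU⟩
  have hne : ¬ InjOn f (core (Finset.univ.image V, V ⟨U, hU⟩) B) := by
    intro h
    have hxcore : x ∈ core (Finset.univ.image V, V ⟨U, hU⟩) B := by
      refine ⟨hx, fun W hW => ?_⟩
      obtain ⟨W, -, rfl⟩ := Finset.mem_image.1 hW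
      exact hxc ▸ hV W
    rw [key _ h] at hxcore
    exact hxcore
  simp only [InjOn, not_forall] at hne
  obtain ⟨y, hy, z, hz, hyz, hne⟩ := hne
  refine ⟨y, ⟨hVW _ hy.1.1, hy.1.2⟩, z, ⟨hVW _ hz.1.1, hz.1.2⟩, hne, hyz, fun W hW => ?_⟩
  exact image_mono (inter_subset_inter_left _ (hVW ⟨W, hW⟩))
    (hy.2 _ (Finset.mem_image_of_mem V (Finset.mem_univ (⟨W, hW⟩ : 𝓕))))

end Polish

theorem IsSplitting.exists_doubling [TopologicalSpace X] [T2Space X] [Nonempty X] {f : X → ℝ} {S : Set X}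
    (hS : IsSplitting f S) {ι : Type*} [DecidableEq ι] (T : Finset ι) {U : ι → Set X}
    (hU : ∀ i ∈ T, IsOpen (U i)) (c : ℝ) (hc : ∀ i ∈ T, c ∈ f '' (U i ∩ S)) (R : Finset ι)
    (hR : R ⊆ T) :
    ∃ (γ : ι → Bool → X) (c' : ℝ), (∀ i ∈ T, ∀ b, γ i b ∈ U i ∩ S ∧ f (γ i b) = c') ∧
      ∀ i ∈ R, γ i true ≠ γ i false := by
  induction R using Finset.induction_on with
  | empty =>
    have : ∀ i, ∃ x, i ∈ T → x ∈ U i ∩ S ∧ f x = c := fun i => by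
      by_cases hi : i ∈ T
      · obtain ⟨x, hx⟩ := hc i hi
        exact ⟨x, fun _ => hx⟩
      · exact ⟨Classical.arbitrary X, fun h => absurd h hi⟩
    choose γ hγ using this
    exact ⟨fun i _ => γ i, c, fun i hi _ => hγ i hi, by simp⟩
  | insert i₀ R _ ih =>
    obtain ⟨γ, c', hγ, hne⟩ := ih ((Finset.subset_insert _ _).trans hR)
    have hsep : ∀ i, ∃ V : Bool → Set X, (∀ b, IsOpen (V b) ∧ γ i b ∈ V b) ∧
        (γ i true ≠ γ i false → Disjoint (V true) (V false)) := by
      intro i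
      by_cases h : γ i true = γ i false
      · exact ⟨fun _ => univ, by simp, fun h' => absurd h h'⟩
      · obtain ⟨V, W, hV, hW, h1, h2, h3⟩ := t2_separation h
        exact ⟨fun b => cond b V W, by simp [hV, hW, h1, h2], fun _ => h3⟩
    choose V hV hVd using hsep
    have hi₀ : i₀ ∈ T := hR (Finset.mem_insert_self _ _)
    obtain ⟨x, hx, y, hy, hxy, hfxy, hall⟩ := hS
      ((fun p : ι × Bool => U p.1 ∩ V p.1 p.2) '' (T ×ˢ Finset.univ : Finset (ι × Bool)))
      ((Finset.finite_toSet _).image _)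
      (by
        rintro _ ⟨⟨i, b⟩, hi, rfl⟩
        exact (hU i (by simpa using hi)).inter (hV i b).1)
      (U i₀ ∩ V i₀ true) ⟨(i₀, true), by simpa using hi₀, rfl⟩ c' (by
        rintro _ ⟨⟨i, b⟩, hi, rfl⟩
        obtain ⟨h1, h2⟩ := hγ i (by simpa using hi) b
        exact ⟨γ i b, ⟨⟨h1.1, (hV i b).2⟩, h1.2⟩, h2⟩)
    have hpt : ∀ i b, ∃ z, i ∈ T → z ∈ (U i ∩ V i b) ∩ S ∧ f z = f x := fun i b => by
      by_cases hi : i ∈ T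
      · obtain ⟨z, hz⟩ := hall _ ⟨(i, b), by simpa using hi, rfl⟩
        exact ⟨z, fun _ => hz⟩
      · exact ⟨x, fun h => absurd h hi⟩
    choose δ hδ using hpt
    refine ⟨fun i b => if i = i₀ then cond b x y else δ i b, f x, fun i hi b => ?_, fun i hi => ?_⟩
    · dsimp only
      split_ifs with h
      · subst h
        cases b
        · exact ⟨⟨hy.1.1, hy.2⟩, hfxy.symm⟩
        · exact ⟨⟨hx.1.1, hx.2⟩, rfl⟩
      · obtain ⟨h1, h2⟩ := hδ i b hi
        exact ⟨⟨h1.1.1, h1.2⟩, h2⟩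
    · dsimp only
      split_ifs with h
      · exact hxy
      · have hiR : i ∈ R := (Finset.mem_insert.1 hi).resolve_left h
        exact (hVd i (hne i hiR)).ne_of_mem (hδ i true (hR hi)).1.1.2 (hδ i false (hR hi)).1.1.2

theorem IsSplitting.exists_shrinking [MetricSpace X] [Nonempty X] {f : X → ℝ} {S : Set X}
    (hS : IsSplitting f S) {ι : Type*} [DecidableEq ι] (T : Finset ι) {U : ι → Set X}
    (hU : ∀ i ∈ T, IsOpen (U i)) (hc : ∃ c, ∀ i ∈ T, c ∈ f '' (U i ∩ S)) {ε : ENNReal}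
    (hε : 0 < ε) :
    ∃ V : ι → Bool → Set X, (∀ i ∈ T, ∀ b, IsOpen (V i b) ∧ closure (V i b) ⊆ U i ∧
      Metric.ediam (V i b) ≤ ε) ∧ (∀ i ∈ T, Disjoint (V i true) (V i false)) ∧
      ∃ c, ∀ i ∈ T, ∀ b, c ∈ f '' (V i b ∩ S) := by
  obtain ⟨c, hc⟩ := hc
  obtain ⟨γ, c', hγ, hne⟩ := hS.exists_doubling T hU c hc T subset_rfl
  have hV : ∀ i, ∃ V : Bool → Set X, i ∈ T → (∀ b, IsOpen (V b) ∧ γ i b ∈ V b ∧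
      closure (V b) ⊆ U i ∧ Metric.ediam (V b) ≤ ε) ∧ Disjoint (V true) (V false) := by
    intro i
    by_cases hi : i ∈ T
    · have hW : ∀ b, ∃ W, IsOpen W ∧ γ i b ∈ W ∧ closure W ⊆ U i ∧ Metric.ediam W ≤ ε := by
        intro b
        obtain ⟨W, hWn, hWc, hWU⟩ := exists_mem_nhds_isClosed_subset
          ((hU i hi).mem_nhds (hγ i hi b).1.1)
        have hball : Metric.eball (γ i b) (ε / 2) ∈ 𝓝 (γ i b) :=
          Metric.eball_mem_nhds _ (ENNReal.half_pos hε.ne')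
        obtain ⟨O, hO, hOo, hmem⟩ := mem_nhds_iff.1 (Filter.inter_mem hWn hball)
        refine ⟨O, hOo, hmem, (closure_minimal (fun z hz => (hO hz).1) hWc).trans hWU, ?_⟩
        calc Metric.ediam O ≤ Metric.ediam (Metric.eball (γ i b) (ε / 2)) :=
              Metric.ediam_mono fun z hz => (hO hz).2
          _ ≤ 2 * (ε / 2) := Metric.ediam_eball_le
          _ = ε := ENNReal.mul_div_cancel two_ne_zero ENNReal.ofNat_ne_top
      choose W hWo hW hWU hWε using hW
      obtain ⟨O₁, O₂, h1, h2, m1, m2, hd⟩ := t2_separation (hne i hi)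
      refine ⟨fun b => W b ∩ cond b O₁ O₂, fun _ => ⟨fun b => ⟨?_, ⟨hW b, ?_⟩, ?_, ?_⟩, ?_⟩⟩
      · exact (hWo b).inter (by cases b <;> assumption)
      · cases b <;> assumption
      · exact (closure_mono inter_subset_left).trans (hWU b)
      · exact (Metric.ediam_mono inter_subset_left).trans (hWε b)
      · exact hd.mono inter_subset_right inter_subset_right
    · exact ⟨fun _ => ∅, fun h => absurd h hi⟩
  choose V hV using hV
  refine ⟨V, fun i hi b => ?_, fun i hi => (hV i hi).2, c', fun i hi b => ?_⟩
  · obtain ⟨h1, -, h2, h3⟩ := (hV i hi).1 b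
    exact ⟨h1, h2, h3⟩
  · exact ⟨γ i b, ⟨((hV i hi).1 b).2.1, (hγ i hi b).1.2⟩, (hγ i hi b).2⟩

theorem IsSplitting.exists_uncountable_fiber [MetricSpace X] [CompleteSpace X] {f : X → ℝ}
    (hf : Continuous f) {S : Set X} (hS : IsSplitting f S) (hne : S.Nonempty) :
    ∃ c, ¬ (f ⁻¹' {c}).Countable := by
  classical
  obtain ⟨x₀, hx₀⟩ := hne
  have : Nonempty X := ⟨x₀⟩
  let L : ℕ → Finset (List Bool) := fun n => (List.finite_length_eq Bool n).toFinset
  have hL : ∀ {n l}, l ∈ L n ↔ l.length = n := by simp [L]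
  let Good : ℕ → (List Bool → Set X) → Prop := fun n U =>
    (∀ l ∈ L n, IsOpen (U l)) ∧ ∃ c, ∀ l ∈ L n, c ∈ f '' (U l ∩ S)
  let Next : ℕ → (List Bool → Set X) → (List Bool → Set X) → Prop := fun n U U' =>
    ∀ l ∈ L n, (∀ b, closure (U' (b :: l)) ⊆ U l ∧ Metric.ediam (U' (b :: l)) ≤ (n + 1 : ENNReal)⁻¹) ∧
      Disjoint (U' (true :: l)) (U' (false :: l))
  have step : ∀ n (U : {U // Good n U}), ∃ U' : {U // Good (n + 1) U}, Next n U.1 U'.1 := by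
    rintro n ⟨U, hUo, hUc⟩
    obtain ⟨V, h1, h2, c, h3⟩ := hS.exists_shrinking (L n) hUo hUc
      (ε := (n + 1 : ENNReal)⁻¹) (by simp)
    let U' : List Bool → Set X := fun l => l.casesOn ∅ fun b l => V l b
    refine ⟨⟨U', ?_, c, ?_⟩, fun l hl => ⟨fun b => (h1 l hl b).2, h2 l hl⟩⟩
    · rintro (_ | ⟨b, l⟩) hl
      · simp [hL] at hl
      · exact (h1 l (hL.2 (by simpa [hL] using hl)) b).1
    · rintro (_ | ⟨b, l⟩) hl
      · simp [hL] at hl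
      · exact h3 l (hL.2 (by simpa [hL] using hl)) b
  choose next hnext using step
  let u : ∀ n, {U // Good n U} := fun n => Nat.rec
    ⟨fun _ => univ, fun _ _ => isOpen_univ, f x₀, fun _ _ => ⟨x₀, ⟨mem_univ _, hx₀⟩, rfl⟩⟩
    (fun n U => next n U) n
  have hu : ∀ n, Next n (u n).1 (u (n + 1)).1 := fun n => hnext n (u n)
  let A : List Bool → Set X := fun l => (u l.length).1 l
  have hanti : CantorScheme.ClosureAntitone A := fun l b => ((hu l.length l (hL.2 rfl)).1 b).1
  have hdiam : CantorScheme.VanishingDiam A := by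
    intro x
    rw [← Filter.tendsto_add_atTop_iff_nat 1]
    refine tendsto_of_tendsto_of_tendsto_of_le_of_le tendsto_const_nhds
      ((Filter.tendsto_add_atTop_iff_nat 1).2 ENNReal.tendsto_inv_nat_nhds_zero)
      (fun _ => bot_le) fun n => ?_
    have := ((hu (PiNat.res x n).length (PiNat.res x n) (hL.2 rfl)).1 (x n)).2
    simpa [A, PiNat.res_length] using this
  have hdisj : CantorScheme.Disjoint A := by
    intro l a b hab
    have := (hu l.length l (hL.2 rfl)).2
    cases a <;> cases b
    exacts [absurd rfl hab, this.symm, this, absurd rfl hab]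
  choose c hc using fun n => (u n).2.2
  have hmem : ∀ l, c l.length ∈ f '' (A l ∩ S) := fun l => hc l.length l (hL.2 rfl)
  have hdom := hanti.map_of_vanishingDiam hdiam fun l => by
    obtain ⟨x, hx, -⟩ := hmem l
    exact ⟨x, hx.1⟩
  let π : (ℕ → Bool) → X := fun x =>
    (CantorScheme.inducedMap A).2 ⟨x, hdom ▸ mem_univ x⟩
  have hπ : Function.Injective π := fun x y h => congrArg Subtype.val (hdisj.map_injective h)
  have hlim : ∀ x, Filter.Tendsto c Filter.atTop (𝓝 (f (π x))) := by
    intro x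
    choose z hz hzc using fun n => hmem (PiNat.res x n)
    simp only [PiNat.res_length] at hzc
    have hzlim : Filter.Tendsto z Filter.atTop (𝓝 (π x)) := by
      rw [tendsto_iff_edist_tendsto_0]
      refine tendsto_of_tendsto_of_tendsto_of_le_of_le tendsto_const_nhds (hdiam x)
        (fun _ => bot_le) fun n => ?_
      exact Metric.edist_le_ediam_of_mem (hz n).1 (CantorScheme.map_mem _ n)
    have := (hf.tendsto _).comp hzlim
    rwa [show f ∘ z = c from funext hzc] at this
  refine ⟨f (π fun _ => true), fun hcount => ?_⟩
  have hrange : range π ⊆ f ⁻¹' {f (π fun _ => true)} := by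
    rintro _ ⟨x, rfl⟩
    exact tendsto_nhds_unique (hlim x) (hlim _)
  have hctble : Countable (ℕ → Bool) := by
    have := (hcount.mono hrange).to_subtype
    exact (injective_codRestrict (fun x => mem_range_self x)).2 hπ |>.countable
  obtain ⟨g, hg⟩ := exists_surjective_nat (ℕ → Bool)
  obtain ⟨n, hn⟩ := hg fun n => !(g n n)
  simpa using congrFun hn n

/-- A countable-to-one Borel function is injective on each piece of a countable Borel cover. -/
theorem exists_measurable_cover_injOn [MeasurableSpace X] [StandardBorelSpace X] {Y : Type*}
    [MeasurableSpace Y] [StandardBorelSpace Y] {f : X → Y} (hf : Measurable f)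
    (hcount : ∀ y, (f ⁻¹' {y}).Countable) :
    ∃ A : ℕ → Set X, (∀ n, MeasurableSet (A n)) ∧ (∀ n, InjOn f (A n)) ∧ ⋃ n, A n = univ := by
  obtain ⟨e, he⟩ := exists_measurableEmbedding_real Y
  have hg : Measurable (e ∘ f) := he.measurable.comp hf
  let t := upgradeStandardBorel X
  obtain ⟨t', htt', hcont, hpol⟩ := hg.exists_continuous
  have hborel : @BorelSpace X t' _ := by
    refine @BorelSpace.mk X t' _ ?_
    rw [eq_borel_upgradeStandardBorel X]
    exact (borel_eq_borel_of_le hpol t.toPolishSpace htt').symm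
  clear htt' t
  let := t'
  obtain ⟨B, ⟨𝓐, h𝓐c, h𝓐, hB⟩, hsplit⟩ := exists_sigmaInjOn_isSplitting_compl hcont
  have hBuniv : B = univ := by
    by_contra h
    let := TopologicalSpace.upgradeIsCompletelyMetrizable X
    obtain ⟨c, hc⟩ := hsplit.exists_uncountable_fiber hcont (nonempty_compl.2 h)
    refine hc ?_
    rcases ((e ∘ f) ⁻¹' {c}).eq_empty_or_nonempty with h0 | ⟨x, rfl⟩
    · simp [h0]
    · exact (hcount (f x)).mono fun y hy => he.injective hy
  obtain ⟨A, hA⟩ := (h𝓐c.insert ∅).exists_eq_range (insert_nonempty _ _)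
  have hAmem : ∀ n, MeasurableSet (A n) ∧ InjOn (e ∘ f) (A n) := by
    intro n
    rcases (hA ▸ mem_range_self n : A n ∈ insert ∅ 𝓐) with h | h
    · simp [h]
    · exact h𝓐 _ h
  refine ⟨A, fun n => (hAmem n).1, fun n x hx y hy h => (hAmem n).2 hx hy (congrArg e h), ?_⟩
  rw [← sUnion_range, ← hA, sUnion_insert, empty_union, ← hB, hBuniv]

end CountableToOne

section Smooth

variable {X : Type*} [MeasurableSpace X]

theorem SmoothER.invariantlyBorelBounded [StandardBorelSpace X] {E : X → X → Prop}
    (hCtble : ∀ x, {y | E x y}.Countable) (h : SmoothER E) : InvariantlyBorelBounded E := by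
  obtain ⟨f, hf, hE⟩ := h
  obtain ⟨A, hAm, hAinj, hA⟩ := exists_measurable_cover_injOn hf fun r => by
    rcases (f ⁻¹' {r}).eq_empty_or_nonempty with h0 | ⟨x, rfl⟩
    · simp [h0]
    · exact (hCtble x).mono fun y hy => (hE x y).2 hy.symm
  intro φ hφ
  have hext : ∀ i, ∃ g : ℝ → ℕ → ℕ, Measurable g ∧ ∀ x ∈ A i, g (f x) = φ x := by
    intro i
    have := (hAm i).standardBorel
    have hemb : MeasurableEmbedding fun x : A i => f x :=
      (hf.comp measurable_subtype_coe).measurableEmbedding (injOn_iff_injective.1 (hAinj i))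
    obtain ⟨g, hg, hgf⟩ := hemb.exists_measurable_extend (hφ.comp measurable_subtype_coe)
      fun _ => inferInstance
    exact ⟨g, hg, fun x hx => congrFun hgf ⟨x, hx⟩⟩
  choose g hg hgf using hext
  refine ⟨fun x n => ∑ i ∈ Finset.range (n + 1), g i (f x) n, ?_, ?_, ?_⟩
  · refine measurable_pi_lambda _ fun n => Finset.measurable_fun_sum _ fun i _ => ?_
    exact (measurable_pi_apply n).comp ((hg i).comp hf)
  · intro x y hxy
    simp only [(hE x y).1 hxy]
  · intro x
    obtain ⟨i, hi⟩ := mem_iUnion.1 (hA.symm ▸ mem_univ x : x ∈ ⋃ n, A n)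
    filter_upwards [Filter.eventually_ge_atTop i] with n hn
    rw [← hgf i x hi]
    exact Finset.single_le_sum (f := fun i => g i (f x) n) (fun _ _ => Nat.zero_le _)
      (Finset.mem_range.2 (by lia))

theorem SmoothER.of_invariant_separating {E : X → X → Prop} {ι : Type*} [Countable ι]
    (V : ι → Set X) (hV : ∀ i, MeasurableSet (V i))
    (hinv : ∀ i x y, E x y → (x ∈ V i ↔ y ∈ V i))
    (hsep : ∀ x y, (∀ i, x ∈ V i ↔ y ∈ V i) → E x y) : SmoothER E := by
  obtain ⟨e, he⟩ := exists_measurableEmbedding_real (ι → Prop)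
  refine ⟨fun x => e fun i => x ∈ V i, ?_, fun x y => ⟨fun h => ?_, fun h => ?_⟩⟩
  · exact he.measurable.comp (measurable_pi_lambda _ fun i => (hV i).mem)
  · exact congrArg e (funext fun i => propext (hinv i x y h))
  · exact hsep x y fun i => iff_of_eq (congrFun (he.injective h) i)

/-- A Borel set that is the graph of a bijection between disjoint sets is contained in the graph
of a Borel involution, which moves points only along this graph. -/
theorem exists_involutive_of_injOn [StandardBorelSpace X] {A : Set (X × X)} (hA : MeasurableSet A)
    (h₁ : InjOn Prod.fst A) (h₂ : InjOn Prod.snd A)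
    (hdisj : Disjoint (Prod.fst '' A) (Prod.snd '' A)) :
    ∃ σ : X → X, Measurable σ ∧ Function.Involutive σ ∧ (∀ p ∈ A, σ p.1 = p.2) ∧
      ∀ x, σ x = x ∨ (x, σ x) ∈ A ∨ (σ x, x) ∈ A := by
  classical
  have hsb := hA.standardBorel
  have hne : ∀ x : X, Nonempty X := fun x => ⟨x⟩
  obtain ⟨g, hg, hgA⟩ := ((measurable_fst.comp measurable_subtype_coe).measurableEmbedding
    (injOn_iff_injective.1 h₁)).exists_measurable_extend
    (measurable_snd.comp (measurable_subtype_coe (p := (· ∈ A)))) hne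
  obtain ⟨k, hk, hkA⟩ := ((measurable_snd.comp measurable_subtype_coe).measurableEmbedding
    (injOn_iff_injective.1 h₂)).exists_measurable_extend
    (measurable_fst.comp (measurable_subtype_coe (p := (· ∈ A)))) hne
  have hg' : ∀ p ∈ A, g p.1 = p.2 := fun p hp => congrFun hgA ⟨p, hp⟩
  have hk' : ∀ p ∈ A, k p.2 = p.1 := fun p hp => congrFun hkA ⟨p, hp⟩
  let σ : X → X := fun x =>
    if x ∈ Prod.fst '' A then g x else if x ∈ Prod.snd '' A then k x else x
  have hσ₁ : ∀ p ∈ A, σ p.1 = p.2 := fun p hp => by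
    simp only [σ, if_pos (mem_image_of_mem Prod.fst hp), hg' p hp]
  have hσ₂ : ∀ p ∈ A, σ p.2 = p.1 := fun p hp => by
    simp only [σ, if_neg (disjoint_right.1 hdisj (mem_image_of_mem Prod.snd hp)),
      if_pos (mem_image_of_mem Prod.snd hp), hk' p hp]
  have hcase : ∀ x, σ x = x ∨ (x, σ x) ∈ A ∨ (σ x, x) ∈ A := by
    intro x
    by_cases hx₁ : x ∈ Prod.fst '' A
    · obtain ⟨p, hp, rfl⟩ := hx₁
      rw [hσ₁ p hp]
      exact Or.inr (Or.inl hp)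
    by_cases hx₂ : x ∈ Prod.snd '' A
    · obtain ⟨p, hp, rfl⟩ := hx₂
      rw [hσ₂ p hp]
      exact Or.inr (Or.inr hp)
    · simp only [σ, if_neg hx₁, if_neg hx₂, true_or]
  refine ⟨σ, ?_, fun x => ?_, hσ₁, hcase⟩
  · exact Measurable.ite (hA.image_of_measurable_injOn measurable_fst h₁) hg
      (Measurable.ite (hA.image_of_measurable_injOn measurable_snd h₂) hk measurable_id)
  · rcases hcase x with h | h | h
    · rw [h, h]
    · exact hσ₂ _ h
    · exact hσ₁ _ h

/-- The Feldman–Moore theorem: a countable Borel equivalence relation is generated by countably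
many Borel involutions. -/
theorem exists_involutions [StandardBorelSpace X] {E : X → X → Prop} (hEq : Equivalence E)
    (hBorel : MeasurableSet {p : X × X | E p.1 p.2}) (hCtble : ∀ x, {y | E x y}.Countable) :
    ∃ σ : ℕ → X → X, (∀ i, Measurable (σ i)) ∧ (∀ i, Function.Involutive (σ i)) ∧
      ∀ x y, E x y ↔ ∃ i, σ i x = y := by
  have hsb := hBorel.standardBorel
  obtain ⟨A, hAm, hA₁, hA⟩ := exists_measurable_cover_injOn
    (f := fun p : {p : X × X | E p.1 p.2} => p.1.1) (measurable_fst.comp measurable_subtype_coe) <| by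
      intro x
      refine MapsTo.countable_of_injOn (f := fun p => p.1.2) (t := {y | E x y}) ?_ ?_ (hCtble x)
      · rintro p rfl
        exact p.2
      · exact fun p hp q hq h => Subtype.ext (Prod.ext (hp.trans hq.symm) h)
  obtain ⟨B, hBm, hB₂, hB⟩ := exists_measurable_cover_injOn
    (f := fun p : {p : X × X | E p.1 p.2} => p.1.2) (measurable_snd.comp measurable_subtype_coe) <| by
      intro x
      refine MapsTo.countable_of_injOn (f := fun p => p.1.1) (t := {y | E x y}) ?_ ?_ (hCtble x)
      · rintro p rfl
        exact hEq.symm p.2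
      · exact fun p hp q hq h => Subtype.ext (Prod.ext h (hp.trans hq.symm))
  let _ := upgradeStandardBorel X
  have hbasis := TopologicalSpace.isBasis_countableBasis X
  let b := TopologicalSpace.countableBasis X
  have : Countable b := (TopologicalSpace.countable_countableBasis X).to_subtype
  let G : ℕ × ℕ × b → Set (X × X) := fun n =>
    (Subtype.val '' (A n.1 ∩ B n.2.1)) ∩ (n.2.2.1 ×ˢ n.2.2.1ᶜ)
  have hGE : ∀ n, ∀ p ∈ G n, E p.1 p.2 := by
    rintro n _ ⟨⟨p, -, rfl⟩, -⟩
    exact p.2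
  have hG : ∀ n, ∃ σ : X → X, Measurable σ ∧ Function.Involutive σ ∧ (∀ p ∈ G n, σ p.1 = p.2) ∧
      ∀ x, σ x = x ∨ (x, σ x) ∈ G n ∨ (σ x, x) ∈ G n := by
    intro n
    refine exists_involutive_of_injOn ?_ ?_ ?_ ?_
    · exact (hBorel.subtype_image ((hAm _).inter (hBm _))).inter
        ((hbasis.isOpen n.2.2.2).measurableSet.prod (hbasis.isOpen n.2.2.2).measurableSet.compl)
    · rintro _ ⟨⟨p, hp, rfl⟩, -⟩ _ ⟨⟨q, hq, rfl⟩, -⟩ h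
      exact congrArg _ (hA₁ _ hp.1 hq.1 h)
    · rintro _ ⟨⟨p, hp, rfl⟩, -⟩ _ ⟨⟨q, hq, rfl⟩, -⟩ h
      exact congrArg _ (hB₂ _ hp.2 hq.2 h)
    · rw [disjoint_left]
      rintro _ ⟨p, hp, rfl⟩ ⟨q, hq, h⟩
      exact hq.2.2 (h ▸ hp.2.1)
  choose σ hσm hσi hσG hσ using hG
  obtain ⟨e, he⟩ := exists_surjective_nat (Option (ℕ × ℕ × b))
  let τ : Option (ℕ × ℕ × b) → X → X := fun o => o.elim id σ
  have hτm : ∀ o, Measurable (τ o) := Option.forall.2 ⟨measurable_id, hσm⟩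
  have hτi : ∀ o, Function.Involutive (τ o) := Option.forall.2 ⟨fun _ => rfl, hσi⟩
  refine ⟨fun i => τ (e i), fun i => hτm (e i), fun i => hτi (e i), fun x y => ?_⟩
  · rw [← he.exists (p := fun o => τ o x = y), Option.exists]
    constructor
    · intro h
      by_cases hxy : x = y
      · exact Or.inl hxy
      · obtain ⟨W, hW, hxW, hWy⟩ :=
          hbasis.exists_subset_of_mem_open (u := {y}ᶜ) hxy isOpen_compl_singleton
        obtain ⟨m, hm⟩ := mem_iUnion.1 (hA.symm ▸ mem_univ (⟨(x, y), h⟩ : {p : X × X | E p.1 p.2}))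
        obtain ⟨n, hn⟩ := mem_iUnion.1 (hB.symm ▸ mem_univ (⟨(x, y), h⟩ : {p : X × X | E p.1 p.2}))
        exact Or.inr ⟨(m, n, ⟨W, hW⟩), hσG (m, n, ⟨W, hW⟩) (x, y)
          ⟨⟨_, ⟨hm, hn⟩, rfl⟩, hxW, fun h => hWy h rfl⟩⟩
    · rintro (h | ⟨n, rfl⟩)
      · exact (show x = y from h) ▸ hEq.refl x
      · change E x (σ n x)
        rcases hσ n x with h | h | h
        · exact h.symm ▸ hEq.refl x
        · exact hGE n _ h
        · exact hEq.symm (hGE n _ h)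

theorem exists_finer_polish_continuous (σ : ℕ → X → X) (hσ : ∀ i, Measurable (σ i))
    (t : TopologicalSpace X) (ht : @PolishSpace X t) (hb : @BorelSpace X t _) :
    ∃ t' : TopologicalSpace X, t' ≤ t ∧ @PolishSpace X t' ∧ @BorelSpace X t' _ ∧
      ∀ i, @Continuous X X t' t (σ i) := by
  have happ : ∀ i, Continuous fun p : ℕ → X => p i := fun i => continuous_apply i
  obtain ⟨t', htt', hcont, hpol⟩ := (measurable_pi_lambda (fun x i => σ i x) hσ).exists_continuous
  refine ⟨t', htt', hpol, @BorelSpace.mk X t' _ ?_, fun i => ?_⟩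
  · rw [hb.measurable_eq, borel_eq_borel_of_le hpol ht htt']
  · exact @Continuous.comp X (ℕ → X) X t' (@Pi.topologicalSpace ℕ (fun _ => X) fun _ => t) t
      (fun x j => σ j x) (fun p => p i) (happ i) hcont

/-- Countably many Borel self-maps of a standard Borel space are continuous for some compatible
Polish topology. -/
theorem exists_polish_continuous [StandardBorelSpace X] (σ : ℕ → X → X)
    (hσ : ∀ i, Measurable (σ i)) :
    ∃ t : TopologicalSpace X, @PolishSpace X t ∧ @BorelSpace X t _ ∧
      ∀ i, @Continuous X X t t (σ i) := by
  let P := {t : TopologicalSpace X // @PolishSpace X t ∧ @BorelSpace X t _}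
  have step : ∀ t : P, ∃ t' : P, t'.1 ≤ t.1 ∧ ∀ i, @Continuous X X t'.1 t.1 (σ i) := by
    rintro ⟨t, ht, hb⟩
    obtain ⟨t', h1, h2, h3, h4⟩ := exists_finer_polish_continuous σ hσ t ht hb
    exact ⟨⟨t', h2, h3⟩, h1, h4⟩
  choose next hle hnext using step
  obtain ⟨t₀, hb₀, hp₀⟩ := StandardBorelSpace.polish (α := X)
  let u : ℕ → P := fun n => next^[n] ⟨t₀, hp₀, hb₀⟩
  have hu : ∀ n, u (n + 1) = next (u n) := fun n => Function.iterate_succ_apply' next n _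
  have hu_anti : Antitone fun n => (u n).1 := antitone_nat_of_succ_le fun n => by
    rw [hu]
    exact hle _
  have hpol : @PolishSpace X (⨅ n, (u n).1) :=
    PolishSpace.iInf ⟨0, fun n => hu_anti (Nat.zero_le n)⟩ fun n => (u n).2.1
  refine ⟨⨅ n, (u n).1, hpol, @BorelSpace.mk X (⨅ n, (u n).1) _ ?_, fun i => ?_⟩
  · rw [borel_eq_borel_of_le hpol (u 0).2.1 (iInf_le _ 0)]
    exact (u 0).2.2.measurable_eq
  · rw [continuous_iInf_rng]
    intro n
    refine continuous_iInf_dom (i := n + 1) ?_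
    rw [hu]
    exact hnext (u n) i

end Smooth

section GenericErgodicity

variable {X : Type*}

theorem mem_residual_or_compl_mem_residual [TopologicalSpace X] [BaireSpace X] {τ : ℕ → X ≃ₜ X}
    {x₀ : X} (hdense : DenseRange fun i => τ i x₀) {B : Set X} (hB : BaireMeasurableSet B)
    (hinv : ∀ i x, τ i x ∈ B ↔ x ∈ B) : B ∈ residual X ∨ Bᶜ ∈ residual X := by
  obtain ⟨u, hu, hBu⟩ := hB.residualEq_isOpen
  obtain ⟨v, hv, hBv⟩ := hB.compl.residualEq_isOpen
  rcases u.eq_empty_or_nonempty with rfl | hune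
  · right
    filter_upwards [hBu.mem_iff] with x hx
    simpa using hx
  rcases v.eq_empty_or_nonempty with rfl | hvne
  · left
    filter_upwards [hBv.mem_iff] with x hx
    simpa using hx
  exfalso
  obtain ⟨i, hi⟩ := hdense.exists_mem_open hu hune
  obtain ⟨j, hj⟩ := hdense.exists_mem_open hv hvne
  let h : X ≃ₜ X := (τ i).symm.trans (τ j)
  have hh : Filter.Tendsto h (residual X) (residual X) :=
    tendsto_residual_of_isOpenMap h.continuous h.isOpenMap
  have hres := dense_of_mem_residual (hBu.mem_iff.and (hh.eventually hBv.mem_iff))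
  obtain ⟨y, ⟨hyu, hyv⟩, hy₁, hy₂⟩ := hres.inter_open_nonempty _
    (hu.inter (hv.preimage h.continuous)) ⟨τ i x₀, hi, by simpa [h] using hj⟩
  refine hy₂.2 hyv ?_
  have h₁ : (τ i).symm y ∈ B := by
    rw [← hinv i]
    simpa using hy₁.2 hyu
  exact (hinv j _).2 h₁

theorem exists_eventually_residual_eq [TopologicalSpace X] [BaireSpace X] [MeasurableSpace X]
    [BorelSpace X] {τ : ℕ → X ≃ₜ X} {x₀ : X} (hdense : DenseRange fun i => τ i x₀)
    {ψ : X → ℕ → ℕ} (hψ : Measurable ψ) (hinv : ∀ i x, ψ (τ i x) = ψ x) :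
    ∃ α : ℕ → ℕ, ∀ᶠ x in residual X, ψ x = α := by
  have : Nonempty X := ⟨x₀⟩
  have hn : ∀ n, ∃ k, ∀ᶠ x in residual X, ψ x n = k := by
    intro n
    by_contra hcon
    have hall : ∀ k, ∀ᶠ x in residual X, ψ x n ≠ k := by
      intro k
      have hm : MeasurableSet {x | ψ x n = k} :=
        ((measurable_pi_apply n).comp hψ) (measurableSet_singleton k)
      exact (mem_residual_or_compl_mem_residual hdense hm.baireMeasurableSet
        fun i x => by simp [hinv]).resolve_left fun h => hcon ⟨k, h⟩
    obtain ⟨x, hx⟩ := (dense_of_mem_residual (eventually_countable_forall.2 hall)).nonempty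
    exact hx _ rfl
  choose α hα using hn
  refine ⟨α, ?_⟩
  filter_upwards [eventually_countable_forall.2 hα] with x hx
  exact funext hx

/-- In a Baire metric space with a dense sequence of non-isolated points, the inverse distances to
the sequence (each taken infinitely often) are generically not eventually dominated. -/
theorem eventually_residual_not_evLe [MetricSpace X] [BaireSpace X] {d : ℕ → X}
    (hdense : DenseRange d) (hiso : ∀ m, Dense ({d m}ᶜ : Set X)) (α : ℕ → ℕ) :
    ∀ᶠ x in residual X, ¬ EvLe (fun n => ⌈(dist x (d n.unpair.1))⁻¹⌉₊) α := by
  have h₁ : ∀ m, ∀ᶠ x in residual X, x ≠ d m := fun m =>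
    residual_of_dense_open isOpen_compl_singleton (hiso m)
  have h₂ : ∀ N, ∀ᶠ x in residual X, ∃ n ≥ N, dist x (d n.unpair.1) < (α n + 1 : ℝ)⁻¹ := by
    intro N
    refine residual_of_dense_open ?_ ?_
    · have : {x | ∃ n ≥ N, dist x (d n.unpair.1) < (α n + 1 : ℝ)⁻¹} =
          ⋃ n ≥ N, Metric.ball (d n.unpair.1) (α n + 1 : ℝ)⁻¹ := by
        ext x
        simp
      exact this ▸ isOpen_biUnion fun n _ => Metric.isOpen_ball
    · refine hdense.mono ?_
      rintro _ ⟨m, rfl⟩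
      refine ⟨Nat.pair m N, Nat.right_le_pair m N, ?_⟩
      simp only [Nat.unpair_pair, dist_self]
      positivity
  filter_upwards [eventually_countable_forall.2 h₁, eventually_countable_forall.2 h₂]
    with x hx₁ hx₂ hle
  obtain ⟨N, hN⟩ := Filter.eventually_atTop.1 hle
  obtain ⟨n, hn, hlt⟩ := hx₂ N
  have hpos : 0 < dist x (d n.unpair.1) := dist_pos.2 (hx₁ _)
  have h := (Nat.ceil_le.1 (hN n hn)).trans_lt (lt_add_one (α n : ℝ))
  exact lt_asymm hlt (inv_lt_of_inv_lt₀ hpos h)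

variable [TopologicalSpace X] [PolishSpace X] [MeasurableSpace X] [BorelSpace X]
  {E : X → X → Prop} {σ : ℕ → X → X}

theorem smoothER_of_isolated (hEq : Equivalence E) (hσc : ∀ i, Continuous (σ i))
    (hE : ∀ x y, E x y ↔ ∃ i, σ i x = y)
    (h : ∀ x, ∃ U, IsOpen U ∧ x ∈ U ∧ ∀ i, σ i x ∈ U → σ i x = x) : SmoothER E := by
  let b := TopologicalSpace.countableBasis X
  have hb := TopologicalSpace.isBasis_countableBasis X
  have : Countable b := (TopologicalSpace.countable_countableBasis X).to_subtype
  let T : b → Set X := fun U => {x | x ∈ U.1 ∧ ∀ i, σ i x ∈ U.1 → σ i x = x}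
  have hT : ∀ U, MeasurableSet (T U) := fun U => by
    have hU := (hb.isOpen U.2).measurableSet
    refine hU.inter (MeasurableSet.congr (MeasurableSet.iInter fun i => ?_) (ofPred_forall _).symm)
    exact ((hσc i).measurable hU).himp (measurableSet_eq_fun (hσc i).measurable measurable_id)
  have huniq : ∀ U x y, x ∈ T U → y ∈ T U → E x y → y = x := by
    intro U x y hx hy hxy
    obtain ⟨i, rfl⟩ := (hE x y).1 hxy
    exact hx.2 i hy.1
  refine SmoothER.of_invariant_separating
    (fun p : b × b => ⋃ i, σ i ⁻¹' (T p.1 ∩ p.2.1)) (fun p => ?_) ?_ ?_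
  · exact MeasurableSet.iUnion fun i =>
      (hσc i).measurable ((hT p.1).inter (hb.isOpen p.2.2).measurableSet)
  · have : ∀ p : b × b, ∀ x y, E x y → x ∈ ⋃ i, σ i ⁻¹' (T p.1 ∩ p.2.1) →
        y ∈ ⋃ i, σ i ⁻¹' (T p.1 ∩ p.2.1) := by
      intro p x y hxy hx
      obtain ⟨i, hi⟩ := mem_iUnion.1 hx
      obtain ⟨j, hj⟩ := (hE y (σ i x)).1 (hEq.trans (hEq.symm hxy) ((hE _ _).2 ⟨i, rfl⟩))
      exact mem_iUnion.2 ⟨j, by rwa [mem_preimage, hj]⟩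
    exact fun p x y hxy => ⟨this p x y hxy, this p y x (hEq.symm hxy)⟩
  · intro x y hxy
    obtain ⟨U, hU, hxU, hUi⟩ := h x
    obtain ⟨W, hW, hxW, hWU⟩ := hb.exists_subset_of_mem_open hxU hU
    have hxT : x ∈ T ⟨W, hW⟩ := ⟨hxW, fun i hi => hUi i (hWU hi)⟩
    have hmeet : ∀ V : b, x ∈ V.1 → ∃ i, σ i y ∈ T ⟨W, hW⟩ ∩ V.1 := by
      intro V hV
      obtain ⟨i, hi⟩ := (hE x x).1 (hEq.refl x)
      exact mem_iUnion.1 ((hxy (⟨W, hW⟩, V)).1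
        (mem_iUnion.2 ⟨i, by rw [mem_preimage, hi]; exact ⟨hxT, hV⟩⟩))
    obtain ⟨i, hi, -⟩ := hmeet ⟨W, hW⟩ hxW
    suffices x = σ i y from hEq.symm ((hE y x).2 ⟨i, this.symm⟩)
    by_contra hne
    obtain ⟨V, hV, hxV, hVne⟩ :=
      hb.exists_subset_of_mem_open (u := {σ i y}ᶜ) hne isOpen_compl_singleton
    obtain ⟨j, hj, hjV⟩ := hmeet ⟨V, hV⟩ hxV
    refine hVne hjV ?_
    exact huniq _ _ _ hi hj (hEq.trans (hEq.symm ((hE _ _).2 ⟨i, rfl⟩)) ((hE _ _).2 ⟨j, rfl⟩))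

theorem InvariantlyBorelBounded.isolated (hEq : Equivalence E) (hσc : ∀ i, Continuous (σ i))
    (hσi : ∀ i, Function.Involutive (σ i)) (hE : ∀ x y, E x y ↔ ∃ i, σ i x = y)
    (hbd : InvariantlyBorelBounded E) (x₀ : X) :
    ∃ U, IsOpen U ∧ x₀ ∈ U ∧ ∀ i, σ i x₀ ∈ U → σ i x₀ = x₀ := by
  by_contra! hcon
  let _ := TopologicalSpace.upgradeIsCompletelyMetrizable X
  let C : Set X := closure (range fun i => σ i x₀)
  have hmaps : ∀ i, MapsTo (σ i) C C := fun i => by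
    refine MapsTo.closure ?_ (hσc i)
    rintro _ ⟨j, rfl⟩
    obtain ⟨k, hk⟩ := (hE x₀ (σ i (σ j x₀))).1
      (hEq.trans ((hE _ _).2 ⟨j, rfl⟩) ((hE _ _).2 ⟨i, rfl⟩))
    exact ⟨k, hk⟩
  have hC : IsClosed C := isClosed_closure
  have hCpol : PolishSpace C := hC.polishSpace
  let τ : ℕ → C ≃ₜ C := fun i =>
    { toFun := (hmaps i).restrict
      invFun := (hmaps i).restrict
      left_inv := fun x => Subtype.ext (hσi i x)
      right_inv := fun x => Subtype.ext (hσi i x)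
      continuous_toFun := (hσc i).restrict (hmaps i)
      continuous_invFun := (hσc i).restrict (hmaps i) }
  obtain ⟨i₀, hi₀⟩ := (hE x₀ x₀).1 (hEq.refl x₀)
  let z₀ : C := ⟨x₀, subset_closure ⟨i₀, hi₀⟩⟩
  have hdense : DenseRange fun i => τ i z₀ := by
    refine IsInducing.subtypeVal.dense_iff.2 fun z => ?_
    rw [← range_comp]
    exact z.2
  have hiso : ∀ m, Dense ({τ m z₀}ᶜ : Set C) := by
    intro m
    refine dense_iff_inter_open.2 fun V hV hVne => ?_
    by_contra hempty
    have hsub : ∀ z ∈ V, z = τ m z₀ := fun z hz => by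
      by_contra h
      exact hempty ⟨z, hz, h⟩
    obtain ⟨z, hz⟩ := hVne
    have hmV : τ m z₀ ∈ V := hsub z hz ▸ hz
    obtain ⟨O, hO, rfl⟩ := isOpen_induced_iff.1 hV
    obtain ⟨i, hi, hne⟩ := hcon (σ m ⁻¹' O) (hO.preimage (hσc m)) hmV
    exact hne (congrArg Subtype.val ((τ m).injective (hsub (τ m (τ i z₀)) hi)))
  obtain ⟨ψ, hψ, hψinv, hle⟩ := hbd (fun x n => ⌈(dist x (σ n.unpair.1 x₀))⁻¹⌉₊) <|
    measurable_pi_lambda _ fun n => by fun_prop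
  obtain ⟨α, hα⟩ := exists_eventually_residual_eq hdense (hψ.comp measurable_subtype_coe)
    fun i x => (hψinv _ _ ((hE _ _).2 ⟨i, rfl⟩)).symm
  have : Nonempty C := ⟨z₀⟩
  obtain ⟨x, hx₁, hx₂⟩ :=
    (dense_of_mem_residual (hα.and (eventually_residual_not_evLe hdense hiso α))).nonempty
  exact hx₂ (hx₁ ▸ hle x)

end GenericErgodicity

/-- A countable Borel equivalence relation on a standard Borel space is smooth
if and only if it is invariantly Borel bounded. -/
theorem smooth_iff_invariantlyBorelBounded
    {X : Type*} [MeasurableSpace X] [StandardBorelSpace X]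
    (E : X → X → Prop) (hEq : Equivalence E)
    (hBorel : MeasurableSet {p : X × X | E p.1 p.2})
    (hCtble : ∀ x, {y | E x y}.Countable) :
    SmoothER E ↔ InvariantlyBorelBounded E := by
  refine ⟨SmoothER.invariantlyBorelBounded hCtble, fun hbd => ?_⟩
  obtain ⟨σ, hσm, hσi, hE⟩ := exists_involutions hEq hBorel hCtble
  obtain ⟨t, hpol, hborel, hσc⟩ := exists_polish_continuous σ hσm
  exact smoothER_of_isolated hEq hσc hE (hbd.isolated hEq hσc hσi hE)
end

section
/- Let E be a countable Borel equivalence relation on a standard Borel space X. Then E is Borel bounded if and only if E has property 𝖻. -/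
open Filter

/-- Eventual equality on `ℕ → ℕ`. -/
def EvEq (α β : ℕ → ℕ) : Prop := ∀ᶠ n in Filter.atTop, α n = β n

/-- `E` is Borel bounded: every Borel `φ : X → ℕ^ℕ` is eventually dominated by
a Borel homomorphism `ψ` from `E` to `=*`. -/
def BorelBounded {X : Type*} [MeasurableSpace X] (E : X → X → Prop) : Prop :=
  ∀ φ : X → ℕ → ℕ, Measurable φ →
    ∃ ψ : X → ℕ → ℕ, Measurable ψ ∧ (∀ x y, E x y → EvEq (ψ x) (ψ y)) ∧
      ∀ x, EvLe (φ x) (ψ x)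

/-- `E` has property `𝖻`: for every Borel homomorphism
`φ : X → (ℕ^ℕ)^ℕ` from `E` to `E_set` (i.e. `x E y` implies the sequences
`φ x` and `φ y` enumerate the same set), there is a Borel homomorphism `ψ`
from `E` to `=*` with `φ(x)(n) ≤* ψ(x)` for all `x` and `n`. -/
def PropertyB {X : Type*} [MeasurableSpace X] (E : X → X → Prop) : Prop :=
  ∀ φ : X → ℕ → ℕ → ℕ, Measurable φ →
    (∀ x y, E x y → Set.range (φ x) = Set.range (φ y)) →
    ∃ ψ : X → ℕ → ℕ, Measurable ψ ∧ (∀ x y, E x y → EvEq (ψ x) (ψ y)) ∧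
      ∀ x n, EvLe (φ x n) (ψ x)

open Set Topology MeasureTheory

/-- A set of pairs is a partial graph if it contains at most one point above each first
coordinate. -/
def IsPartialGraph {X Y : Type*} (C : Set (X × Y)) : Prop :=
  ∀ x y y', (x, y) ∈ C → (x, y') ∈ C → y = y'

/-- A countable union of Borel partial graphs. -/
def IsSigmaGraph {X Y : Type*} [MeasurableSpace X] [MeasurableSpace Y] (G : Set (X × Y)) : Prop :=
  ∃ C : ℕ → Set (X × Y), (∀ n, MeasurableSet (C n) ∧ IsPartialGraph (C n)) ∧ G = ⋃ n, C n

section SigmaGraph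

variable {X Y : Type*} [MeasurableSpace X] [MeasurableSpace Y]

lemma IsPartialGraph.isSigmaGraph {C : Set (X × Y)} (hC : IsPartialGraph C)
    (hm : MeasurableSet C) : IsSigmaGraph C :=
  ⟨fun _ => C, fun _ => ⟨hm, hC⟩, (iUnion_const C).symm⟩

lemma IsSigmaGraph.empty : IsSigmaGraph (∅ : Set (X × Y)) :=
  IsPartialGraph.isSigmaGraph (fun _ _ _ h => h.elim) MeasurableSet.empty

lemma IsSigmaGraph.measurableSet {G : Set (X × Y)} (hG : IsSigmaGraph G) : MeasurableSet G := by
  obtain ⟨C, hC, rfl⟩ := hG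
  exact MeasurableSet.iUnion fun n => (hC n).1

lemma IsSigmaGraph.iUnion {ι : Type*} [Countable ι] {G : ι → Set (X × Y)}
    (hG : ∀ i, IsSigmaGraph (G i)) : IsSigmaGraph (⋃ i, G i) := by
  cases isEmpty_or_nonempty ι
  · simpa using IsSigmaGraph.empty
  choose C hC hG using hG
  obtain ⟨e, he⟩ := exists_surjective_nat (ι × ℕ)
  refine ⟨fun n => C (e n).1 (e n).2, fun n => hC _ _, ?_⟩
  rw [he.iUnion_comp (fun p : ι × ℕ => C p.1 p.2), iUnion_prod']
  exact iUnion_congr hG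

lemma IsSigmaGraph.union {G H : Set (X × Y)} (hG : IsSigmaGraph G) (hH : IsSigmaGraph H) :
    IsSigmaGraph (G ∪ H) := by
  rw [union_eq_iUnion]
  exact IsSigmaGraph.iUnion (by rintro (_ | _) <;> assumption)

end SigmaGraph

/-- An analytic partial graph is contained in a Borel partial graph. -/
lemma exists_measurable_partialGraph {W X Y : Type*}
    [MeasurableSpace W] [StandardBorelSpace W]
    [TopologicalSpace X] [PolishSpace X] [MeasurableSpace X] [BorelSpace X]
    [MeasurableSpace Y] [StandardBorelSpace Y]
    {S : Set W} (hS : MeasurableSet S) {α : W → X} {β : W → Y}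
    (hα : Measurable α) (hβ : Measurable β)
    (h : ∀ w ∈ S, ∀ w' ∈ S, α w = α w' → β w = β w') :
    ∃ C : Set (X × Y), MeasurableSet C ∧ IsPartialGraph C ∧ ∀ w ∈ S, (α w, β w) ∈ C := by
  obtain ⟨U, hU, hsep⟩ := exists_seq_separating (α := Y) MeasurableSet.empty univ
  have key : ∀ n, MeasurablySeparable (α '' (S ∩ β ⁻¹' U n)) (α '' (S ∩ β ⁻¹' (U n)ᶜ)) := by
    intro n
    refine AnalyticSet.measurablySeparable
      ((hS.inter (hβ (hU n))).analyticSet_image hα)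
      ((hS.inter (hβ (hU n).compl)).analyticSet_image hα) ?_
    rw [disjoint_left]
    rintro _ ⟨w, ⟨hw, hwU⟩, rfl⟩ ⟨w', ⟨hw', hwU'⟩, he⟩
    rw [mem_preimage, ← h w hw w' hw' he.symm] at hwU'
    exact hwU' hwU
  choose B hB1 hB2 hBm using key
  refine ⟨⋂ n, {p : X × Y | p.2 ∈ U n ↔ p.1 ∈ B n}, ?_, ?_, ?_⟩
  · exact MeasurableSet.iInter fun n =>
      MeasurableSet.iff (measurable_snd (hU n)) (measurable_fst (hBm n))
  · intro x y y' hy hy'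
    simp only [mem_iInter, mem_ofPred_eq] at hy hy'
    exact hsep y (mem_univ _) y' (mem_univ _) fun n => (hy n).trans (hy' n).symm
  · intro w hw
    simp only [mem_iInter, mem_ofPred_eq]
    refine fun n => ⟨fun hu => hB1 n ⟨w, ⟨hw, hu⟩, rfl⟩, fun hb => ?_⟩
    by_contra hu
    exact disjoint_left.1 (hB2 n) ⟨w, ⟨hw, hu⟩, rfl⟩ hb

/-- The sequences lying in a single fibre of `a` whose images under `(a, b)` avoid `G`. -/
def fiberSequences {X Y Z : Type*} (a : Z → X) (b : Z → Y) (G : Set (X × Y)) : Set (ℕ → Z) :=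
  {z | (∀ i j, a (z i) = a (z j)) ∧ ∀ i, (a (z i), b (z i)) ∉ G}

lemma fiberSequences_anti {X Y Z : Type*} (a : Z → X) (b : Z → Y) {G H : Set (X × Y)}
    (h : G ⊆ H) : fiberSequences a b H ⊆ fiberSequences a b G :=
  fun _ hz => ⟨hz.1, fun i hi => hz.2 i (h hi)⟩

lemma isClosed_fiberSequences_empty {X Y Z : Type*} [TopologicalSpace X] [T2Space X]
    [TopologicalSpace Z] {a : Z → X} (ha : Continuous a) (b : Z → Y) :
    IsClosed (fiberSequences a b ∅) := by
  have : fiberSequences a b ∅ = ⋂ i, ⋂ j, {z : ℕ → Z | a (z i) = a (z j)} := by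
    ext z; simp [fiberSequences]
  rw [this]
  exact isClosed_iInter fun i => isClosed_iInter fun j =>
    isClosed_eq (by fun_prop) (by fun_prop)

/-- If every point of a sequence inside one fibre of `a` is a limit of points of the sequence
with a different `b`-value, then `b` takes uncountably many values on that fibre. -/
lemma not_countable_of_accumulating {X Y Z : Type*} [TopologicalSpace X] [T1Space X]
    [TopologicalSpace Y] [T1Space Y] [MetricSpace Z] [CompleteSpace Z]
    {a : Z → X} {b : Z → Y} (ha : Continuous a) (hb : Continuous b) {x : X} {z : ℕ → Z}
    (hx : ∀ i, a (z i) = x)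
    (hz : ∀ i, ∀ ε > 0, ∃ j, dist (z j) (z i) < ε ∧ b (z j) ≠ b (z i)) :
    ¬ (b '' (a ⁻¹' {x})).Countable := by
  intro hc
  have hK : closure (range z) ⊆ a ⁻¹' {x} :=
    closure_minimal (range_subset_iff.2 hx) (isClosed_singleton.preimage ha)
  have : Countable (b '' (a ⁻¹' {x})) := hc.to_subtype
  have : CompleteSpace (closure (range z)) := isClosed_closure.completeSpace_coe
  have : Nonempty (closure (range z)) := ⟨⟨z 0, subset_closure ⟨0, rfl⟩⟩⟩
  obtain ⟨y, k, hk⟩ := nonempty_interior_of_iUnion_of_closed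
    (f := fun y : b '' (a ⁻¹' {x}) => {k : closure (range z) | b k = y})
    (fun y => isClosed_singleton.preimage (hb.comp continuous_subtype_val))
    (eq_univ_of_forall fun k => mem_iUnion.2 ⟨⟨b k, mem_image_of_mem b (hK k.2)⟩, rfl⟩)
  obtain ⟨V, hVsub, hV, hkV⟩ := mem_interior.1 hk
  obtain ⟨O, hO, rfl⟩ := isOpen_induced_iff.1 hV
  obtain ⟨_, hiO, i, rfl⟩ := mem_closure_iff.1 k.2 O hO hkV
  obtain ⟨ε, hε, hball⟩ := Metric.isOpen_iff.1 hO _ hiO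
  obtain ⟨j, hj, hne⟩ := hz i ε hε
  have hval : ∀ l, z l ∈ O → b (z l) = y := fun l hl =>
    hVsub (a := ⟨z l, subset_closure ⟨l, rfl⟩⟩) hl
  exact hne ((hval j (hball hj)).trans (hval i hiO).symm)

/-- A set `L` of sequences that can be split at every coordinate and is closed under inserting
the resulting points has a sequence in its closure accumulating at each of its points. -/
lemma exists_accumulating_sequence {Y Z : Type*} [TopologicalSpace Y] [T2Space Y]
    [MetricSpace Z] [CompleteSpace Z] {b : Z → Y} (hb : Continuous b)
    {L : Set (ℕ → Z)} (hL : L.Nonempty)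
    (hsplit : ∀ O : Set (ℕ → Z), IsOpen O → (O ∩ L).Nonempty → ∀ i, ∃ z ∈ O ∩ L, ∃ z' ∈ O ∩ L,
      b (z' i) ≠ b (z i) ∧ ∀ j, Function.update z j (z' i) ∈ L) :
    ∃ z ∈ closure L, ∀ i, ∀ ε > 0, ∃ j, dist (z j) (z i) < ε ∧ b (z j) ≠ b (z i) := by
  have : TopologicalSpace.IsCompletelyMetrizableSpace (closure L) :=
    isClosed_closure.isCompletelyMetrizableSpace
  have : Nonempty (closure L) := hL.closure.to_subtype
  let D : ℕ × ℕ → Set (closure L) := fun p => {t | ∃ j,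
    dist (t.1 j) (t.1 p.1) < 1 / ((p.2 : ℝ) + 1) ∧ b (t.1 j) ≠ b (t.1 p.1)}
  have hDo : ∀ p, IsOpen (D p) := by
    intro p
    have heval : ∀ j, Continuous fun t : closure L => t.1 j := fun j =>
      (continuous_apply j).comp continuous_subtype_val
    simp only [D, ofPred_exists]
    refine isOpen_iUnion fun j => IsOpen.inter ?_ ?_
    · exact isOpen_lt ((heval j).dist (heval p.1)) continuous_const
    · exact isOpen_ne_fun (hb.comp (heval j)) (hb.comp (heval p.1))
  have hDd : ∀ p, Dense (D p) := by
    rintro ⟨i, k⟩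
    rw [dense_iff_inter_open]
    rintro V hV ⟨t, ht⟩
    obtain ⟨O, hO, rfl⟩ := isOpen_induced_iff.1 hV
    obtain ⟨w, hwO, hwL⟩ := mem_closure_iff.1 t.2 O hO ht
    have hε : (0 : ℝ) < 1 / ((k : ℝ) + 1) := by positivity
    set ε : ℝ := 1 / ((k : ℝ) + 1)
    have hO' : IsOpen (O ∩ {v : ℕ → Z | dist (v i) (w i) < ε / 2}) :=
      hO.inter (isOpen_lt (by fun_prop) (by fun_prop))
    obtain ⟨z, ⟨hzO, hzL⟩, z', ⟨hzO', hzL'⟩, hne, hupd⟩ :=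
      hsplit _ hO' ⟨w, ⟨hwO, by simpa using half_pos hε⟩, hwL⟩ i
    obtain ⟨I, u, hu, hsub⟩ := isOpen_pi_iff.1 hO z hzO.1
    obtain ⟨j, hj⟩ := Infinite.exists_notMem_finset (insert i I)
    rw [Finset.mem_insert, not_or] at hj
    refine ⟨⟨Function.update z j (z' i), subset_closure (hupd j)⟩, hsub fun l hl => ?_, j, ?_⟩
    · have hlj : l ≠ j := by rintro rfl; exact hj.2 hl
      simpa [Function.update_of_ne hlj] using (hu l hl).2
    · simp only [Function.update_self, Function.update_of_ne (Ne.symm hj.1)]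
      refine ⟨?_, hne⟩
      calc dist (z' i) (z i) ≤ dist (z' i) (w i) + dist (z i) (w i) := dist_triangle_right _ _ _
        _ < ε / 2 + ε / 2 := add_lt_add hzO'.2 hzO.2
        _ = ε := add_halves ε
  obtain ⟨t, ht⟩ := (dense_iInter_of_isOpen hDo hDd).nonempty
  refine ⟨t, t.2, fun i ε hε => ?_⟩
  obtain ⟨k, hk⟩ := exists_nat_one_div_lt hε
  obtain ⟨j, hj, hne⟩ := mem_iInter.1 ht (i, k)
  exact ⟨j, hj.trans hk, hne⟩

/-- Lusin–Novikov: a continuous image of a Polish space in `X × Y` with countable sections is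
covered by countably many Borel partial graphs. -/
theorem exists_isSigmaGraph_cover {X Y Z : Type*}
    [TopologicalSpace X] [PolishSpace X] [MeasurableSpace X] [BorelSpace X]
    [TopologicalSpace Y] [PolishSpace Y] [MeasurableSpace Y] [BorelSpace Y]
    [TopologicalSpace Z] [PolishSpace Z] {a : Z → X} {b : Z → Y}
    (ha : Continuous a) (hb : Continuous b) (hc : ∀ x, (b '' (a ⁻¹' {x})).Countable) :
    ∃ G : Set (X × Y), IsSigmaGraph G ∧ ∀ z, (a z, b z) ∈ G := by
  let := TopologicalSpace.upgradeIsCompletelyMetrizable Z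
  let : MeasurableSpace Z := borel Z
  have : BorelSpace Z := ⟨rfl⟩
  -- A single `G₀` handles every basic open set which some `G` can empty.
  have hdead : ∀ O : TopologicalSpace.countableBasis (ℕ → Z), ∃ G : Set (X × Y),
      IsSigmaGraph G ∧ ∀ H, IsSigmaGraph H → O.1 ∩ fiberSequences a b H = ∅ →
        O.1 ∩ fiberSequences a b G = ∅ := by
    intro O
    by_cases h : ∃ H, IsSigmaGraph H ∧ O.1 ∩ fiberSequences a b H = ∅
    · obtain ⟨H, hH, hOH⟩ := h
      exact ⟨H, hH, fun _ _ _ => hOH⟩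
    · exact ⟨∅, IsSigmaGraph.empty, fun H hH hOH => (h ⟨H, hH, hOH⟩).elim⟩
  choose G hG hGmax using hdead
  have : Countable (TopologicalSpace.countableBasis (ℕ → Z)) :=
    (TopologicalSpace.countable_countableBasis _).to_subtype
  set G₀ := ⋃ O, G O
  have hG₀ : IsSigmaGraph G₀ := IsSigmaGraph.iUnion hG
  set L := fiberSequences a b G₀ with hLdef
  have hlive : ∀ O : Set (ℕ → Z), IsOpen O → (O ∩ L).Nonempty → ∀ H, IsSigmaGraph H →
      (O ∩ fiberSequences a b H).Nonempty := by
    rintro O hO ⟨z, hzO, hzL⟩ H hH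
    obtain ⟨O', hO'mem, hzO', hO'⟩ :=
      (TopologicalSpace.isBasis_countableBasis (ℕ → Z)).exists_subset_of_mem_open hzO hO
    rw [nonempty_iff_ne_empty]
    intro hemp
    have := hGmax ⟨O', hO'mem⟩ H hH
      (subset_empty_iff.1 (hemp ▸ inter_subset_inter_left _ hO'))
    exact (this ▸ (⟨hzO', fiberSequences_anti a b (subset_iUnion G _) hzL⟩ :
      z ∈ O' ∩ fiberSequences a b (G ⟨O', hO'mem⟩)) : z ∈ (∅ : Set (ℕ → Z)))
  refine ⟨G₀, hG₀, fun z₀ => ?_⟩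
  by_contra hz₀
  have hLne : L.Nonempty := ⟨fun _ => z₀, fun _ _ => rfl, fun _ => hz₀⟩
  have hLm : MeasurableSet L := by
    have hL : L = fiberSequences a b ∅ ∩ ⋂ i, (fun z : ℕ → Z => (a (z i), b (z i))) ⁻¹' G₀ᶜ := by
      ext z; simp [hLdef, fiberSequences]
    rw [hL]
    refine (isClosed_fiberSequences_empty ha b).measurableSet.inter
      (MeasurableSet.iInter fun i => ?_)
    exact ((ha.measurable.comp (measurable_pi_apply i)).prodMk
      (hb.measurable.comp (measurable_pi_apply i))) hG₀.measurableSet.compl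
  have hsplit : ∀ O : Set (ℕ → Z), IsOpen O → (O ∩ L).Nonempty → ∀ i, ∃ z ∈ O ∩ L,
      ∃ z' ∈ O ∩ L, b (z' i) ≠ b (z i) ∧ ∀ j, Function.update z j (z' i) ∈ L := by
    intro O hO hOL i
    have hpair : ∃ z ∈ O ∩ L, ∃ z' ∈ O ∩ L, a (z' i) = a (z i) ∧ b (z' i) ≠ b (z i) := by
      by_contra! hcon
      obtain ⟨C, hCm, hC, hmem⟩ := exists_measurable_partialGraph
        (hO.measurableSet.inter hLm) (ha.measurable.comp (measurable_pi_apply i))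
        (hb.measurable.comp (measurable_pi_apply i))
        (fun w hw w' hw' h => hcon w' hw' w hw h)
      obtain ⟨z, hzO, hz⟩ := hlive O hO hOL _ (hG₀.union (hC.isSigmaGraph hCm))
      exact hz.2 i (Or.inr (hmem z ⟨hzO, fiberSequences_anti a b subset_union_left hz⟩))
    obtain ⟨z, hz, z', hz', hab, hne⟩ := hpair
    refine ⟨z, hz, z', hz', hne, fun j => ?_⟩
    have hval : ∀ l, a (Function.update z j (z' i) l) = a (z i) := by
      intro l
      rcases eq_or_ne l j with rfl | hl
      · simpa using hab
      · simpa [Function.update_of_ne hl] using hz.2.1 l i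
    refine ⟨fun l m => (hval l).trans (hval m).symm, fun l => ?_⟩
    rcases eq_or_ne l j with rfl | hl
    · simpa using hz'.2.2 i
    · simpa [Function.update_of_ne hl] using hz.2.2 l
  obtain ⟨z, hz, hacc⟩ := exists_accumulating_sequence hb hLne hsplit
  have hzW : z ∈ fiberSequences a b ∅ :=
    closure_minimal (fiberSequences_anti a b (empty_subset _))
      (isClosed_fiberSequences_empty ha b) hz
  exact not_countable_of_accumulating ha hb (fun i => hzW.1 i 0) hacc (hc _)

/-- The classes of a countable Borel equivalence relation are enumerated by a sequence of Borel
functions. -/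
theorem exists_measurable_enumeration {X : Type*} [MeasurableSpace X] [StandardBorelSpace X]
    (E : X → X → Prop) (hEq : Equivalence E)
    (hBorel : MeasurableSet {p : X × X | E p.1 p.2}) (hCtble : ∀ x, {y | E x y}.Countable) :
    ∃ f : ℕ → X → X, (∀ n, Measurable (f n)) ∧ ∀ x, range (fun n => f n x) = {y | E x y} := by
  classical
  let := upgradeStandardBorel X
  have hcover : ∃ G : Set (X × X), IsSigmaGraph G ∧ {p : X × X | E p.1 p.2} ⊆ G := by
    have hA := hBorel.analyticSet
    rw [AnalyticSet] at hA
    rcases hA with h | ⟨g, hg, hrange⟩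
    · exact ⟨∅, IsSigmaGraph.empty, h.subset⟩
    have hgE : ∀ z, E (g z).1 (g z).2 := fun z => hrange.subset (mem_range_self z)
    obtain ⟨G, hG, hmem⟩ := exists_isSigmaGraph_cover hg.fst hg.snd fun x =>
      (hCtble x).mono (by rintro _ ⟨z, rfl, rfl⟩; exact hgE z)
    refine ⟨G, hG, ?_⟩
    rw [← hrange]
    rintro _ ⟨z, rfl⟩
    exact hmem z
  obtain ⟨_, ⟨C, hC, rfl⟩, hsub⟩ := hcover
  let f : ℕ → X → X := fun n x => if h : ∃ y, E x y ∧ (x, y) ∈ C n then h.choose else x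
  have hf : ∀ n x y, E x y → (x, y) ∈ C n → f n x = y := by
    intro n x y hxy hy
    have h : ∃ y, E x y ∧ (x, y) ∈ C n := ⟨y, hxy, hy⟩
    simp only [f, dif_pos h]
    exact (hC n).2 x _ _ h.choose_spec.2 hy
  have hproj : ∀ n (A : Set X), MeasurableSet A →
      MeasurableSet {x | ∃ y, E x y ∧ (x, y) ∈ C n ∧ y ∈ A} := by
    intro n A hA
    have him : {x | ∃ y, E x y ∧ (x, y) ∈ C n ∧ y ∈ A} =
        Prod.fst '' ({p : X × X | E p.1 p.2} ∩ (C n ∩ Prod.snd ⁻¹' A)) := by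
      ext x; simp
    rw [him]
    refine (hBorel.inter ((hC n).1.inter (measurable_snd hA))).image_of_measurable_injOn
      measurable_fst ?_
    rintro ⟨x, y⟩ hp ⟨_, y'⟩ hp' rfl
    exact Prod.ext rfl ((hC n).2 x y y' hp.2.1 hp'.2.1)
  refine ⟨f, fun n A hA => ?_, fun x => ?_⟩
  · have hpre : f n ⁻¹' A = {x | ∃ y, E x y ∧ (x, y) ∈ C n ∧ y ∈ A} ∪
        (A \ {x | ∃ y, E x y ∧ (x, y) ∈ C n ∧ y ∈ univ}) := by
      ext x
      by_cases h : ∃ y, E x y ∧ (x, y) ∈ C n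
      · obtain ⟨y, hxy, hy⟩ := h
        have hiff : (∃ y, E x y ∧ (x, y) ∈ C n ∧ y ∈ A) ↔ y ∈ A :=
          ⟨fun ⟨y', _, hy', hA'⟩ => (hC n).2 x y y' hy hy' ▸ hA', fun hyA => ⟨y, hxy, hy, hyA⟩⟩
        have hex : ∃ y, E x y ∧ (x, y) ∈ C n ∧ y ∈ univ := ⟨y, hxy, hy, trivial⟩
        simp only [mem_preimage, hf n x y hxy hy, mem_union, Set.mem_sdiff, mem_ofPred_eq, hiff, hex,
          not_true_eq_false, and_false, or_false]
      · have hfx : f n x = x := dif_neg h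
        have hnA : ¬ ∃ y, E x y ∧ (x, y) ∈ C n ∧ y ∈ A :=
          fun ⟨y, hxy, hy, _⟩ => h ⟨y, hxy, hy⟩
        have hnu : ¬ ∃ y, E x y ∧ (x, y) ∈ C n ∧ y ∈ univ :=
          fun ⟨y, hxy, hy, _⟩ => h ⟨y, hxy, hy⟩
        simp only [mem_preimage, hfx, mem_union, Set.mem_sdiff, mem_ofPred_eq, hnA, hnu,
          not_false_eq_true, and_true, false_or]
    rw [hpre]
    exact (hproj n A hA).union (hA.diff (hproj n univ MeasurableSet.univ))
  · apply Subset.antisymm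
    · rintro _ ⟨n, rfl⟩
      by_cases h : ∃ y, E x y ∧ (x, y) ∈ C n
      · obtain ⟨y, hxy, hy⟩ := h
        simpa only [mem_ofPred_eq, hf n x y hxy hy] using hxy
      · have hfx : f n x = x := dif_neg h
        simpa only [mem_ofPred_eq, hfx] using hEq.refl x
    · intro y hxy
      obtain ⟨n, hn⟩ := mem_iUnion.1 (hsub (show (x, y) ∈ {p : X × X | E p.1 p.2} from hxy))
      exact ⟨n, hf n x y hxy hn⟩

/-- A countable Borel equivalence relation on a standard Borel space is Borel
bounded if and only if it has property `𝖻`. -/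
theorem borelBounded_iff_propertyB
    {X : Type*} [MeasurableSpace X] [StandardBorelSpace X]
    (E : X → X → Prop) (hEq : Equivalence E)
    (hBorel : MeasurableSet {p : X × X | E p.1 p.2})
    (hCtble : ∀ x, {y | E x y}.Countable) :
    BorelBounded E ↔ PropertyB E := by
  constructor
  · intro h φ hφ _
    obtain ⟨ψ, hψ, hhom, hle⟩ := h (fun x n => ∑ i ∈ Finset.range (n + 1), φ x i n) <| by
      refine measurable_pi_lambda _ fun n => Finset.measurable_fun_sum _ fun i _ => ?_
      exact (measurable_pi_apply n).comp ((measurable_pi_apply i).comp hφ)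
    refine ⟨ψ, hψ, hhom, fun x n => ?_⟩
    filter_upwards [hle x, eventually_ge_atTop n] with k hk hnk
    exact (Finset.single_le_sum (f := fun i => φ x i k) (fun _ _ => Nat.zero_le _)
      (Finset.mem_range.2 (by omega))).trans hk
  · intro h φ hφ
    obtain ⟨f, hf, hrange⟩ := exists_measurable_enumeration E hEq hBorel hCtble
    obtain ⟨ψ, hψ, hhom, hle⟩ := h (fun x n => φ (f n x))
      (measurable_pi_lambda _ fun n => hφ.comp (hf n)) <| by
        intro x y hxy
        have hclass : {z | E x z} = {z | E y z} :=
          Set.ext fun z => ⟨hEq.trans (hEq.symm hxy), hEq.trans hxy⟩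
        have himage : ∀ x, range (fun n => φ (f n x)) = φ '' {z | E x z} := fun x => by
          rw [← hrange x, ← range_comp]; rfl
        rw [himage, himage, hclass]
    refine ⟨ψ, hψ, hhom, fun x => ?_⟩
    obtain ⟨n, hn⟩ := (hrange x).symm.subset (hEq.refl x)
    have hx := hle x n
    simp only at hn
    rwa [hn] at hx
end

section
/- Let E and F be countable Borel equivalence relations on standard Borel spaces X and Y respectively, let 𝐀 be an invariant relation, and let Φ be a property of subsets of A₊. If E ≤_B F and F is Borel non-(𝐀,Φ), then E is Borel non-(𝐀,Φ). -/
open Filter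

/-- An invariant relation `𝐀 = (A₋, A₊, A)`: `A₋` and `A₊` are Borel subsets of
`ℕ^ℕ` (with `2^ℕ = 𝒫(ℕ)` regarded as `{0,1}`-valued functions), and the
relation `A` respects eventual equality on both sides. -/
structure InvRelation where
  neg : Set (ℕ → ℕ)
  pos : Set (ℕ → ℕ)
  negBorel : MeasurableSet neg
  posBorel : MeasurableSet pos
  rel : (ℕ → ℕ) → (ℕ → ℕ) → Prop
  invariant : ∀ x x' y y', x ∈ neg → x' ∈ neg → y ∈ pos → y' ∈ pos →
    EvEq x x' → EvEq y y' → (rel x y ↔ rel x' y')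

/-- `E` is Borel non-`(𝐀,Φ)`: for every Borel homomorphism `φ : X → (A₊)^ℕ`
from `E` to `E_set(A₊)` such that each family `{φ(x)(n) : n ∈ ℕ}` has property
`Φ`, there is a Borel homomorphism `ψ : X → A₋` from `E` to `E₀(A₋)` with
`¬(ψ(x) A φ(x)(n))` for all `x` and `n`. -/
def BorelNonRel (A : InvRelation) (Φ : Set (ℕ → ℕ) → Prop)
    {X : Type*} [MeasurableSpace X] (E : X → X → Prop) : Prop :=
  ∀ φ : X → ℕ → ℕ → ℕ, Measurable φ → (∀ x n, φ x n ∈ A.pos) →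
    (∀ x y, E x y → Set.range (φ x) = Set.range (φ y)) →
    (∀ x, Φ (Set.range (φ x))) →
    ∃ ψ : X → ℕ → ℕ, Measurable ψ ∧ (∀ x, ψ x ∈ A.neg) ∧
      (∀ x y, E x y → EvEq (ψ x) (ψ y)) ∧ ∀ x n, ¬ A.rel (ψ x) (φ x n)

open Set TopologicalSpace MeasureTheory Topology

/-- `W` is a countable union of Borel sets on each of which `a` is injective. -/
def IsSigmaInjective {Z X : Type*} [MeasurableSpace Z] (a : Z → X) (W : Set Z) : Prop :=
  ∃ 𝒞 : Set (Set Z), 𝒞.Countable ∧ (∀ C ∈ 𝒞, MeasurableSet C ∧ InjOn a C) ∧ W = ⋃₀ 𝒞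

namespace IsSigmaInjective

variable {Z X : Type*} [MeasurableSpace Z] {a : Z → X}

theorem measurableSet {W : Set Z} (hW : IsSigmaInjective a W) : MeasurableSet W := by
  obtain ⟨𝒞, hc, h, rfl⟩ := hW
  exact MeasurableSet.sUnion hc fun C hC => (h C hC).1

theorem of_injOn {D : Set Z} (hD : MeasurableSet D) (hinj : InjOn a D) :
    IsSigmaInjective a D :=
  ⟨{D}, countable_singleton D, by simp [hD, hinj], by simp⟩

theorem iUnion {ι : Type*} [Countable ι] {W : ι → Set Z} (hW : ∀ i, IsSigmaInjective a (W i)) :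
    IsSigmaInjective a (⋃ i, W i) := by
  choose 𝒞 hc h hU using hW
  refine ⟨⋃ i, 𝒞 i, countable_iUnion hc, ?_, ?_⟩
  · intro C hC
    obtain ⟨i, hi⟩ := mem_iUnion.1 hC
    exact h i C hi
  · rw [sUnion_iUnion]
    exact iUnion_congr hU

theorem union {W V : Set Z} (hW : IsSigmaInjective a W) (hV : IsSigmaInjective a V) :
    IsSigmaInjective a (W ∪ V) := by
  rw [union_eq_iUnion]
  exact iUnion (by rintro (_ | _) <;> assumption)

end IsSigmaInjective

/-- An analytic set on which a Borel map is injective is contained in a Borel set with the same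
property. -/
theorem MeasureTheory.AnalyticSet.exists_measurableSet_injOn {Z X : Type*} [TopologicalSpace Z]
    [PolishSpace Z] [MeasurableSpace Z] [BorelSpace Z] [MeasurableSpace X] [MeasurableEq X]
    {a : Z → X} (ha : Measurable a) {P : Set Z} (hP : AnalyticSet P) (hinj : InjOn a P) :
    ∃ D, P ⊆ D ∧ MeasurableSet D ∧ InjOn a D := by
  have hT : MeasurableSet {w : Z × Z | a w.1 = a w.2 ∧ w.1 ≠ w.2} :=
    (measurableSet_eq_fun (ha.comp measurable_fst) (ha.comp measurable_snd)).inter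
      (measurableSet_eq_fun measurable_fst measurable_snd).compl
  have companions : ∀ S : Set Z, AnalyticSet S →
      AnalyticSet (Prod.snd '' ((Prod.fst ⁻¹' S) ∩ {w : Z × Z | a w.1 = a w.2 ∧ w.1 ≠ w.2})) := by
    intro S hS
    refine AnalyticSet.image_of_continuous ?_ continuous_snd
    rw [inter_eq_iInter]
    refine AnalyticSet.iInter ?_
    rintro (_ | _)
    · exact hT.analyticSet
    · exact hS.preimage continuous_fst
  obtain ⟨B, hPB, hB, hBm⟩ := hP.measurablySeparable (companions P hP) (by
    rw [Set.disjoint_left]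
    rintro z hz ⟨⟨p, z'⟩, ⟨hp, h1, h2⟩, rfl⟩
    exact h2 (hinj hp hz h1))
  obtain ⟨D, hPD, hD, hDm⟩ := hP.measurablySeparable (companions B hBm.analyticSet) (by
    rw [Set.disjoint_left]
    rintro z hz ⟨⟨b, z'⟩, ⟨hb, h1, h2⟩, rfl⟩
    exact Set.disjoint_left.1 hB ⟨(z', b), ⟨hz, h1.symm, h2.symm⟩, rfl⟩ hb)
  refine ⟨B ∩ D, subset_inter hPB hPD, hBm.inter hDm, ?_⟩
  intro x hx y hy hxy
  by_contra hne
  exact Set.disjoint_left.1 hD ⟨(x, y), ⟨hx.1, hxy, hne⟩, rfl⟩ hy.2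

section Scheme

variable {Z X : Type*} [TopologicalSpace Z] [SecondCountableTopology Z]

/-- The open set of values allowed at coordinate `j` by the finite set of constraints `s`. -/
def cell (s : Finset (ℕ × countableBasis Z)) (j : ℕ) : Set Z :=
  {z | ∀ V : countableBasis Z, (j, V) ∈ s → z ∈ V.1}

theorem cell_anti {s t : Finset (ℕ × countableBasis Z)} (h : s ⊆ t) (j : ℕ) :
    cell t j ⊆ cell s j := fun _ hz V hV => hz V (h hV)

theorem isOpen_cell (s : Finset (ℕ × countableBasis Z)) (j : ℕ) : IsOpen (cell s j) := by
  have : cell s j = ⋂ e ∈ s, {z | e.1 = j → z ∈ e.2.1} := by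
    ext z
    simp only [cell, mem_ofPred_eq, mem_iInter]
    constructor
    · rintro h ⟨i, V⟩ he rfl
      exact h V he
    · intro h V hV
      exact h (j, V) hV rfl
  rw [this]
  refine isOpen_biInter_finset fun e _ => ?_
  by_cases h : e.1 = j
  · simpa [h] using isOpen_of_mem_countableBasis e.2.2
  · simp [h]

/-- Sequences in a single fibre of `a` that avoid `W` and obey the constraints `s`. -/
def configs (a : Z → X) (s : Finset (ℕ × countableBasis Z)) (W : Set Z) : Set (ℕ → Z) :=
  {p | (∀ j, p j ∈ cell s j) ∧ (∀ j, p j ∉ W) ∧ ∀ j, a (p j) = a (p 0)}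

/-- The constraints `s` can be made unsatisfiable by removing countably many Borel sets on which
`a` is injective. -/
def Negligible [MeasurableSpace Z] (a : Z → X) (s : Finset (ℕ × countableBasis Z)) : Prop :=
  ∃ W, IsSigmaInjective a W ∧ configs a s W = ∅

theorem exists_isSigmaInjective_forall_negligible [MeasurableSpace Z] (a : Z → X) :
    ∃ W, IsSigmaInjective a W ∧ ∀ s, Negligible a s → configs a s W = ∅ := by
  have h : ∀ s : {s // Negligible a s}, ∃ W, IsSigmaInjective a W ∧ configs a s.1 W = ∅ :=
    fun s => s.2
  choose W hW hs using h
  refine ⟨⋃ s, W s, IsSigmaInjective.iUnion hW, fun s hn => ?_⟩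
  rw [eq_empty_iff_forall_notMem]
  intro p hp
  exact eq_empty_iff_forall_notMem.1 (hs ⟨s, hn⟩) p
    ⟨hp.1, fun j hj => hp.2.1 j (mem_iUnion.2 ⟨⟨s, hn⟩, hj⟩), hp.2.2⟩

theorem Negligible.of_injOn_coordinate [IsCompletelyMetrizableSpace Z]
    [MeasurableSpace Z] [BorelSpace Z] [MeasurableSpace X] [MeasurableEq X] {a : Z → X}
    (ha : Measurable a) {s : Finset (ℕ × countableBasis Z)} {W : Set Z}
    (hW : IsSigmaInjective a W) (i : ℕ)
    (h : ∀ p ∈ configs a s W, ∀ q ∈ configs a s W, a (p 0) = a (q 0) → p i = q i) :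
    Negligible a s := by
  have hm : MeasurableSet (configs a s W) := by
    have : configs a s W = (⋂ j, (fun p : ℕ → Z => p j) ⁻¹' cell s j) ∩
        ((⋂ j, (fun p : ℕ → Z => p j) ⁻¹' Wᶜ) ∩ ⋂ j, {p | a (p j) = a (p 0)}) := by
      ext p
      simp [configs]
    rw [this]
    refine (MeasurableSet.iInter fun j => ?_).inter
      ((MeasurableSet.iInter fun j => ?_).inter (MeasurableSet.iInter fun j => ?_))
    · exact measurable_pi_apply j (isOpen_cell s j).measurableSet
    · exact measurable_pi_apply j hW.measurableSet.compl
    · exact measurableSet_eq_fun (ha.comp (measurable_pi_apply j))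
        (ha.comp (measurable_pi_apply 0))
  have hA : AnalyticSet ((fun p : ℕ → Z => p i) '' configs a s W) :=
    hm.analyticSet_image (measurable_pi_apply i)
  obtain ⟨D, hPD, hD, hinj⟩ := hA.exists_measurableSet_injOn ha (by
    rintro _ ⟨p, hp, rfl⟩ _ ⟨q, hq, rfl⟩ hpq
    exact h p hp q hq (by rw [← hp.2.2 i, ← hq.2.2 i]; exact hpq))
  refine ⟨W ∪ D, hW.union (.of_injOn hD hinj), eq_empty_iff_forall_notMem.2 fun p hp => ?_⟩
  exact hp.2.1 i (Or.inr (hPD ⟨p, ⟨hp.1, fun j hj => hp.2.1 j (Or.inl hj), hp.2.2⟩, rfl⟩))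

end Scheme

/-- The invariant of the construction at stage `n`: the constraints `s` are not negligible, only
concern coordinates up to `n`, and confine those below `n` to sets of diameter at most `2⁻ⁿ`. -/
structure GoodStage {Z X : Type*} [MetricSpace Z] [SecondCountableTopology Z] [MeasurableSpace Z]
    (a : Z → X) (n : ℕ) (s : Finset (ℕ × countableBasis Z)) : Prop where
  not_negligible : ¬ Negligible a s
  fresh : ∀ e ∈ s, e.1 ≤ n
  small : ∀ j < n, ∀ x ∈ cell s j, ∀ y ∈ cell s j, dist x y ≤ (1 / 2 : ℝ) ^ n

theorem GoodStage.exists_split {Z X : Type*} [MetricSpace Z] [CompleteSpace Z]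
    [SecondCountableTopology Z] [MeasurableSpace Z] [BorelSpace Z]
    [MeasurableSpace X] [MeasurableEq X] {a : Z → X} (ha : Measurable a)
    {n : ℕ} {s : Finset (ℕ × countableBasis Z)} (hs : GoodStage a n s) {i : ℕ} (hi : i ≤ n) :
    ∃ t, s ⊆ t ∧ GoodStage a (n + 1) t ∧
      Disjoint (closure (cell t i)) (closure (cell t (n + 1))) ∧
      cell t (n + 1) ⊆ cell s i := by
  classical
  obtain ⟨W, hW, hWs⟩ := exists_isSigmaInjective_forall_negligible a
  obtain ⟨p, hp, q, hq, hpq, hne⟩ : ∃ p ∈ configs a s W, ∃ q ∈ configs a s W,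
      a (p 0) = a (q 0) ∧ p i ≠ q i := by
    by_contra! h
    exact hs.not_negligible (.of_injOn_coordinate ha hW i h)
  set r : ℕ → Z := Function.update p (n + 1) (q i) with hr
  have hr_new : r (n + 1) = q i := by simp [hr]
  have hr_old : ∀ j, j ≠ n + 1 → r j = p j := fun j hj => by simp [hr, hj]
  have hd : 0 < dist (p i) (q i) := dist_pos.2 hne
  set ε : ℝ := min ((1 / 2 : ℝ) ^ (n + 1) / 2) (dist (p i) (q i) / 3)
  have hε0 : 0 < ε := by positivity
  have hε1 : ε ≤ (1 / 2 : ℝ) ^ (n + 1) / 2 := min_le_left _ _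
  have hε2 : ε ≤ dist (p i) (q i) / 3 := min_le_right _ _
  have hV : ∀ j, ∃ V : countableBasis Z, r j ∈ V.1 ∧ V.1 ⊆ Metric.ball (r j) ε ∧
      (j = n + 1 → V.1 ⊆ cell s i) := by
    intro j
    obtain ⟨V, hVb, hjV, hVs⟩ := (isBasis_countableBasis Z).exists_subset_of_mem_open
      (a := r j) (u := Metric.ball (r j) ε ∩ {z | j = n + 1 → z ∈ cell s i})
      ⟨Metric.mem_ball_self hε0, by rintro rfl; rw [hr_new]; exact hq.1 i⟩
      (Metric.isOpen_ball.inter (by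
        by_cases h : j = n + 1
        · simpa [h] using isOpen_cell s i
        · simp [h]))
    exact ⟨⟨V, hVb⟩, hjV, fun z hz => (hVs hz).1, fun h z hz => (hVs hz).2 h⟩
  choose V hrV hVball hVs using hV
  set t : Finset (ℕ × countableBasis Z) :=
    s ∪ (Finset.range (n + 2)).image fun j => (j, V j)
  have hmem : ∀ j ≤ n + 1, (j, V j) ∈ t := fun j hj =>
    Finset.mem_union_right _ (Finset.mem_image_of_mem _ (Finset.mem_range.2 (by omega)))
  have hball : ∀ j ≤ n + 1, cell t j ⊆ Metric.ball (r j) ε := fun j hj z hz =>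
    hVball j (hz _ (hmem j hj))
  refine ⟨t, Finset.subset_union_left, ⟨?_, ?_, ?_⟩, ?_, fun z hz =>
    hVs (n + 1) rfl (hz _ (hmem _ le_rfl))⟩
  · intro hneg
    refine eq_empty_iff_forall_notMem.1 (hWs t hneg) r ⟨?_, ?_, ?_⟩
    · intro j U hU
      rcases Finset.mem_union.1 hU with h | h
      · have hj : j ≠ n + 1 := by
          have := hs.fresh _ h
          simp only at this
          omega
        rw [hr_old j hj]
        exact hp.1 j U h
      · obtain ⟨k, -, hk⟩ := Finset.mem_image.1 h
        obtain ⟨rfl, rfl⟩ := Prod.mk.inj hk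
        exact hrV _
    · intro j
      by_cases hj : j = n + 1
      · rw [hj, hr_new]; exact hq.2.1 i
      · rw [hr_old j hj]; exact hp.2.1 j
    · intro j
      rw [hr_old 0 (by omega)]
      by_cases hj : j = n + 1
      · rw [hj, hr_new, hpq]; exact hq.2.2 i
      · rw [hr_old j hj]; exact hp.2.2 j
  · intro e he
    rcases Finset.mem_union.1 he with h | h
    · exact (hs.fresh e h).trans (Nat.le_succ n)
    · obtain ⟨k, hk, rfl⟩ := Finset.mem_image.1 h
      have := Finset.mem_range.1 hk
      simp only
      omega
  · intro j hj x hx y hy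
    have h1 := Metric.mem_ball.1 (hball j hj.le hx)
    have h2 := Metric.mem_ball.1 (hball j hj.le hy)
    have h3 := dist_triangle_right x y (r j)
    linarith
  · have hcl : ∀ j ≤ n + 1, closure (cell t j) ⊆ Metric.closedBall (r j) ε := fun j hj =>
      (closure_mono (hball j hj)).trans Metric.closure_ball_subset_closedBall
    refine (Metric.closedBall_disjoint_closedBall ?_).mono (hcl i (by omega)) (hcl _ le_rfl)
    rw [hr_new, hr_old i (by omega)]
    linarith

/-- **Lusin–Novikov**, covering form: a Polish space with a continuous countable-to-one map is a
countable union of Borel sets on which the map is injective. -/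
theorem isSigmaInjective_univ_of_continuous {Z X : Type*} [MetricSpace Z] [CompleteSpace Z]
    [SecondCountableTopology Z] [MeasurableSpace Z] [BorelSpace Z]
    [TopologicalSpace X] [T2Space X] [SecondCountableTopology X]
    [MeasurableSpace X] [BorelSpace X] {a : Z → X} (ha : Continuous a)
    (hc : ∀ x, (a ⁻¹' {x}).Countable) : IsSigmaInjective a univ := by
  by_contra hcon
  have h0 : GoodStage a 0 (∅ : Finset (ℕ × countableBasis Z)) := by
    refine ⟨?_, by simp, by simp⟩
    rintro ⟨W, hW, he⟩
    have : W = univ := eq_univ_of_forall fun z => by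
      by_contra hz
      exact eq_empty_iff_forall_notMem.1 he (fun _ => z)
        ⟨fun j V hV => by simp at hV, fun _ => hz, fun _ => rfl⟩
    exact hcon (this ▸ hW)
  have hstep : ∀ n (s : {s // GoodStage a n s}), ∃ t : {t // GoodStage a (n + 1) t},
      s.1 ⊆ t.1 ∧ Disjoint (closure (cell t.1 n.unpair.1)) (closure (cell t.1 (n + 1))) ∧
      cell t.1 (n + 1) ⊆ cell s.1 n.unpair.1 := by
    intro n s
    obtain ⟨t, hst, ht, h⟩ := s.2.exists_split ha.measurable (Nat.unpair_left_le n)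
    exact ⟨⟨t, ht⟩, hst, h⟩
  choose next hnext using hstep
  let S : ∀ n, {s // GoodStage a n s} := fun n => Nat.rec ⟨∅, h0⟩ next n
  have hS : ∀ n, (S n).1 ⊆ (S (n + 1)).1 ∧
      Disjoint (closure (cell (S (n + 1)).1 n.unpair.1)) (closure (cell (S (n + 1)).1 (n + 1))) ∧
      cell (S (n + 1)).1 (n + 1) ⊆ cell (S n).1 n.unpair.1 := fun n => hnext n (S n)
  have hmono : Monotone fun n => (S n).1 := monotone_nat_of_le_succ fun n => (hS n).1
  have hp : ∀ n, ∃ p, p ∈ configs a (S n).1 ∅ := by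
    intro n
    by_contra! h
    exact (S n).2.not_negligible ⟨∅, .of_injOn .empty (by simp), eq_empty_iff_forall_notMem.2 h⟩
  choose p hp using hp
  have hpc : ∀ j n m, n ≤ m → p m j ∈ cell (S n).1 j := fun j n m hnm =>
    cell_anti (hmono hnm) j ((hp m).1 j)
  have hlim : ∀ j, ∃ z, Tendsto (fun n => p n j) atTop (𝓝 z) := by
    intro j
    refine cauchySeq_tendsto_of_complete (Metric.cauchySeq_iff.2 fun ε hε => ?_)
    obtain ⟨N, hN⟩ := exists_pow_lt_of_lt_one hε (by norm_num : (1 / 2 : ℝ) < 1)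
    refine ⟨max N (j + 1), fun m hm k hk => ?_⟩
    refine ((S (max N (j + 1))).2.small j (by omega) _ (hpc j _ m hm) _ (hpc j _ k hk)).trans_lt ?_
    exact (pow_le_pow_of_le_one (by norm_num) (by norm_num) (le_max_left _ _)).trans_lt hN
  choose z hz using hlim
  have hzc : ∀ j n, z j ∈ closure (cell (S n).1 j) := fun j n =>
    mem_closure_of_tendsto (hz j) ((eventually_ge_atTop n).mono fun m hm => hpc j n m hm)
  have hza : ∀ j, a (z j) = a (z 0) := fun j => by
    refine tendsto_nhds_unique ((ha.tendsto _).comp (hz j)) ?_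
    refine ((ha.tendsto _).comp (hz 0)).congr fun n => ?_
    exact ((hp n).2.2 j).symm
  have hpre : Preperfect (range z) := by
    rw [preperfect_iff_nhds]
    rintro _ ⟨i, rfl⟩ U hU
    obtain ⟨ε, hε, hεU⟩ := Metric.mem_nhds_iff.1 hU
    obtain ⟨N, hN⟩ := exists_pow_lt_of_lt_one hε (by norm_num : (1 / 2 : ℝ) < 1)
    set n := Nat.pair i (max N (i + 1)) with hn
    have hni : n.unpair.1 = i := by simp [hn]
    have hle : max N (i + 1) ≤ n := Nat.right_le_pair _ _
    have hdist : dist (z (n + 1)) (z i) ≤ (1 / 2 : ℝ) ^ n := by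
      have h1 : z (n + 1) ∈ closure (cell (S n).1 i) := by
        have := closure_mono (hS n).2.2 (hzc (n + 1) (n + 1))
        rwa [hni] at this
      have hsub : closure (cell (S n).1 i) ×ˢ closure (cell (S n).1 i) ⊆
          {w : Z × Z | dist w.1 w.2 ≤ (1 / 2 : ℝ) ^ n} := by
        rw [← closure_prod_eq]
        refine closure_minimal (fun w hw => ?_) (isClosed_le continuous_dist continuous_const)
        exact (S n).2.small i (by omega) _ hw.1 _ hw.2
      exact hsub (mk_mem_prod h1 (hzc i n))
    refine ⟨z (n + 1), ⟨hεU ?_, mem_range_self _⟩, fun heq => ?_⟩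
    · refine Metric.mem_ball.2 (hdist.trans_lt ?_)
      exact (pow_le_pow_of_le_one (by norm_num) (by norm_num)
        ((le_max_left _ _).trans hle)).trans_lt hN
    · have hdisj := (hS n).2.1
      rw [hni] at hdisj
      exact Set.disjoint_left.1 hdisj (hzc i (n + 1)) (heq ▸ hzc (n + 1) (n + 1))
  obtain ⟨g, hg, -, hginj⟩ := hpre.perfect_closure.exists_nat_bool_injection
    ((range_nonempty z).mono subset_closure)
  have hsub : closure (range z) ⊆ a ⁻¹' {a (z 0)} :=
    closure_minimal (by rintro _ ⟨j, rfl⟩; exact hza j) (isClosed_singleton.preimage ha)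
  have hcount : (range g).Countable := (hc _).mono (hg.trans hsub)
  have : Countable (ℕ → Bool) := by
    rw [← image_univ] at hcount
    exact countable_univ_iff.1 (countable_of_injective_of_countable_image hginj.injOn hcount)
  have hcard := Cardinal.mk_le_aleph0_iff.2 this
  simp only [Cardinal.mk_pi, Cardinal.mk_bool, Cardinal.prod_const, Cardinal.mk_nat,
    Cardinal.lift_aleph0, Cardinal.lift_ofNat] at hcard
  exact (Cardinal.cantor _).not_ge hcard

/-- **Lusin–Novikov**, covering form, for Borel maps between standard Borel spaces. -/
theorem isSigmaInjective_univ {Z X : Type*} [MeasurableSpace Z] [StandardBorelSpace Z]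
    [MeasurableSpace X] [StandardBorelSpace X] {a : Z → X} (ha : Measurable a)
    (hc : ∀ x, (a ⁻¹' {x}).Countable) : IsSigmaInjective a univ := by
  let := upgradeStandardBorel X
  let := upgradeStandardBorel Z
  have hZ : PolishSpace Z := inferInstance
  obtain ⟨t, hle, hcont, hpol⟩ := ha.exists_continuous
  have hborel : @BorelSpace Z t _ := by
    constructor
    rw [borel_eq_borel_of_le hpol hZ hle]
    exact BorelSpace.measurable_eq
  let : TopologicalSpace Z := t
  let := upgradeIsCompletelyMetrizable Z
  exact isSigmaInjective_univ_of_continuous hcont hc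

/-- **Lusin–Novikov**, uniformization form: a countable-to-one Borel map has Borel range and
admits a Borel right inverse on its range. -/
theorem exists_measurable_rightInverse_of_countable_fibers {Z X : Type*} [MeasurableSpace Z]
    [StandardBorelSpace Z] [Nonempty Z] [MeasurableSpace X] [StandardBorelSpace X] {a : Z → X}
    (ha : Measurable a) (hc : ∀ x, (a ⁻¹' {x}).Countable) :
    MeasurableSet (range a) ∧ ∃ h : X → Z, Measurable h ∧ ∀ x ∈ range a, a (h x) = x := by
  classical
  obtain ⟨𝒞, hcount, h𝒞, huniv⟩ := isSigmaInjective_univ ha hc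
  have hne : 𝒞.Nonempty := by
    rw [nonempty_iff_ne_empty]
    rintro rfl
    simp at huniv
  obtain ⟨C, rfl⟩ := hcount.exists_eq_range hne
  have hCm : ∀ n, MeasurableSet (C n) := fun n => (h𝒞 _ (mem_range_self n)).1
  have hCi : ∀ n, InjOn a (C n) := fun n => (h𝒞 _ (mem_range_self n)).2
  have hrange : range a = ⋃ n, a '' C n := by
    rw [← image_iUnion, ← image_univ, huniv, sUnion_range]
  have him : ∀ n, MeasurableSet (a '' C n) := fun n =>
    (hCm n).image_of_measurable_injOn ha (hCi n)
  have hrm : MeasurableSet (range a) := by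
    rw [hrange]
    exact .iUnion him
  set G : Set Z := ⋃ n, C n ∩ a ⁻¹' disjointed (fun n => a '' C n) n
  have hGm : MeasurableSet G :=
    .iUnion fun n => (hCm n).inter (ha (MeasurableSet.disjointed him n))
  have hGi : InjOn a G := by
    intro x hx y hy hxy
    obtain ⟨n, hxn, hxd⟩ := mem_iUnion.1 hx
    obtain ⟨m, hym, hyd⟩ := mem_iUnion.1 hy
    have hnm : n = m := by
      by_contra h
      exact Set.disjoint_left.1 (disjoint_disjointed (fun n => a '' C n) h) hxd
        (by rw [mem_preimage, ← hxy] at hyd; exact hyd)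
    subst hnm
    exact hCi n hxn hym hxy
  have hGr : ∀ x ∈ range a, ∃ z ∈ G, a z = x := by
    intro x hx
    rw [hrange, ← iUnion_disjointed] at hx
    obtain ⟨n, hn⟩ := mem_iUnion.1 hx
    obtain ⟨z, hz, rfl⟩ := disjointed_subset _ n hn
    exact ⟨z, mem_iUnion.2 ⟨n, hz, hn⟩, rfl⟩
  obtain ⟨z₀⟩ := ‹Nonempty Z›
  have hh : ∀ x, ∃ z, (x ∈ range a → z ∈ G ∧ a z = x) ∧ (x ∉ range a → z = z₀) := by
    intro x
    by_cases hx : x ∈ range a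
    · obtain ⟨z, hz⟩ := hGr x hx
      exact ⟨z, fun _ => hz, fun h => (h hx).elim⟩
    · exact ⟨z₀, fun h => (hx h).elim, fun _ => rfl⟩
  choose h hin hout using hh
  refine ⟨hrm, h, fun D hD => ?_, fun x hx => (hin x hx).2⟩
  have : h ⁻¹' D = a '' (G ∩ D) ∪ ((range a)ᶜ ∩ {_x | z₀ ∈ D}) := by
    ext x
    by_cases hx : x ∈ range a
    · simp only [mem_preimage, mem_union, mem_inter_iff, mem_compl_iff, hx, not_true_eq_false,
        false_and, or_false]
      constructor
      · exact fun hD => ⟨h x, ⟨(hin x hx).1, hD⟩, (hin x hx).2⟩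
      · rintro ⟨z, ⟨hzG, hzD⟩, hzx⟩
        rwa [hGi (hin x hx).1 hzG ((hin x hx).2.trans hzx.symm)]
    · have hni : x ∉ a '' (G ∩ D) := fun ⟨z, _, hz⟩ => hx ⟨z, hz⟩
      simp only [mem_preimage, mem_union, mem_inter_iff, mem_compl_iff, hx, not_false_eq_true,
        true_and, hni, false_or, hout x hx, mem_ofPred_eq]
  rw [this]
  exact ((hGm.inter hD).image_of_measurable_injOn ha (hGi.mono inter_subset_left)).union
    (hrm.compl.inter (.const _))

/-- If `E ≤_B F` (there is a Borel reduction from `E` to `F`) and `F` is Borel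
non-`(𝐀,Φ)`, then so is `E`. -/
theorem borelNonRel_of_borelReducible
    {X Y : Type*} [MeasurableSpace X] [StandardBorelSpace X]
    [MeasurableSpace Y] [StandardBorelSpace Y]
    (A : InvRelation) (Φ : Set (ℕ → ℕ) → Prop)
    (E : X → X → Prop) (F : Y → Y → Prop)
    (hEeq : Equivalence E) (hEBorel : MeasurableSet {p : X × X | E p.1 p.2})
    (hECtble : ∀ x, {y | E x y}.Countable)
    (hFeq : Equivalence F) (hFBorel : MeasurableSet {p : Y × Y | F p.1 p.2})
    (hFCtble : ∀ y, {z | F y z}.Countable)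
    (f : X → Y) (hf : Measurable f) (hred : ∀ x y, E x y ↔ F (f x) (f y))
    (hF : BorelNonRel A Φ F) :
    BorelNonRel A Φ E := by
  intro φ hφ hpos hhom hΦ
  rcases isEmpty_or_nonempty X with hX | ⟨⟨x₀⟩⟩
  · exact ⟨fun x => hX.elim x, measurable_of_empty _, fun x => hX.elim x, fun x => hX.elim x,
      fun x => hX.elim x⟩
  let R : Set (Y × X) := {p | F p.1 (f p.2)}
  have hR : MeasurableSet R :=
    (measurable_fst.prodMk (hf.comp measurable_snd)) hFBorel
  have : StandardBorelSpace R := hR.standardBorel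
  have : Nonempty R := ⟨⟨(f x₀, x₀), hFeq.refl _⟩⟩
  let a : R → Y := fun p => p.1.1
  have ha : Measurable a := measurable_fst.comp measurable_subtype_coe
  have hc : ∀ y, (a ⁻¹' {y}).Countable := by
    intro y
    rcases (a ⁻¹' {y}).eq_empty_or_nonempty with he | ⟨r, hr⟩
    · rw [he]; exact countable_empty
    refine Set.MapsTo.countable_of_injOn (f := fun p : R => p.1.2) (t := {x | E r.1.2 x}) ?_ ?_
      (hECtble _)
    · intro p hp
      refine (hred _ _).2 (hFeq.trans (hFeq.symm r.2) ?_)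
      have : r.1.1 = p.1.1 := hr.trans hp.symm
      rw [this]
      exact p.2
    · intro p hp q hq hpq
      exact Subtype.ext (Prod.ext (hp.trans hq.symm) hpq)
  obtain ⟨hSm, g, hg, hag⟩ := exists_measurable_rightInverse_of_countable_fibers ha hc
  have hS : ∀ y, y ∈ range a ↔ ∃ x, F y (f x) := fun y =>
    ⟨by rintro ⟨p, rfl⟩; exact ⟨p.1.2, p.2⟩, fun ⟨x, hx⟩ => ⟨⟨(y, x), hx⟩, rfl⟩⟩
  classical
  let h : Y → X := (range a).piecewise (fun y => (g y).1.2) fun _ => x₀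
  have hh : Measurable h :=
    Measurable.piecewise hSm (measurable_snd.comp (measurable_subtype_coe.comp hg))
      measurable_const
  have hhS : ∀ y ∈ range a, F y (f (h y)) := by
    intro y hy
    have h1 : h y = (g y).1.2 := piecewise_eq_of_mem _ _ _ hy
    have h2 : F (g y).1.1 (f (g y).1.2) := (g y).2
    have h3 : (g y).1.1 = y := hag y hy
    rw [h1]
    rwa [h3] at h2
  have hFh : ∀ y y', F y y' → E (h y) (h y') := by
    intro y y' hyy
    by_cases hy : y ∈ range a
    · have hy' : y' ∈ range a := by
        obtain ⟨x, hx⟩ := (hS y).1 hy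
        exact (hS y').2 ⟨x, hFeq.trans (hFeq.symm hyy) hx⟩
      exact (hred _ _).2 (hFeq.trans (hFeq.symm (hhS y hy)) (hFeq.trans hyy (hhS y' hy')))
    · have hy' : y' ∉ range a := by
        intro hy'
        obtain ⟨x, hx⟩ := (hS y').1 hy'
        exact hy ((hS y).2 ⟨x, hFeq.trans hyy hx⟩)
      have h1 : h y = x₀ := piecewise_eq_of_notMem _ _ _ hy
      have h2 : h y' = x₀ := piecewise_eq_of_notMem _ _ _ hy'
      rw [h1, h2]
      exact hEeq.refl _
  obtain ⟨ψ, hψ, hneg, hψhom, hψA⟩ := hF (fun y => φ (h y)) (hφ.comp hh)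
    (fun y n => hpos _ n) (fun y y' hyy => hhom _ _ (hFh y y' hyy)) fun y => hΦ _
  refine ⟨fun x => ψ (f x), hψ.comp hf, fun x => hneg _,
    fun x y hxy => hψhom _ _ ((hred x y).1 hxy), fun x n => ?_⟩
  have hE : E x (h (f x)) := (hred _ _).2 (hhS _ ((hS _).2 ⟨x, hFeq.refl _⟩))
  obtain ⟨m, hm⟩ : φ x n ∈ range (φ (h (f x))) := hhom _ _ hE ▸ mem_range_self n
  rw [← hm]
  exact hψA (f x) m
end
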